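/- For every integer N ≥ 5, let ι : SO(N) ↪ SU(N) be the inclusion of real special orthogonal N×N matrices into SU(N). The image of the induced homomorphism ι₊ : π₃(SO(N), 1) → π₃(SU(N), 1) on third homotopy groups equals the subgroup {x² : x ∈ π₃(SU(N), 1)} of squares of elements of π₃(SU(N), 1). (In particular, since π₃(SU(N)) ≅ ℤ, the image is the index-2 subgroup.) -/

import Mathlib

open Matrix
open scoped Topology Topology.Homotopy

noncomputable section

/-- The special unitary group `SU(n)`, i.e. the group of unitary `n×n` complex matrices of
determinant one, as a subgroup of the unitary group (so that its topology is the subspace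
topology from the `n×n` complex matrices). -/
def SU (n : ℕ) : Subgroup (Matrix.unitaryGroup (Fin n) ℂ) :=
  (Matrix.detMonoidHom.comp (Matrix.unitaryGroup (Fin n) ℂ).subtype).ker

/-- The special orthogonal group `SO(n)`, i.e. the group of real orthogonal `n×n` matrices of
determinant one (with the subspace topology from the `n×n` real matrices). -/
def SOr (n : ℕ) : Subgroup (Matrix.unitaryGroup (Fin n) ℝ) :=
  (Matrix.detMonoidHom.comp (Matrix.unitaryGroup (Fin n) ℝ).subtype).ker

variable {n : ℕ}

private lemma star_mapMatrix (B : Matrix (Fin n) (Fin n) ℝ) :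
    star (Complex.ofRealHom.mapMatrix B) = Complex.ofRealHom.mapMatrix (star B) := by
  rw [Matrix.star_eq_conjTranspose, Matrix.star_eq_conjTranspose]
  ext i j
  simp [conjTranspose_apply, Matrix.map_apply, Complex.conj_ofReal]

/-- The inclusion of the real special orthogonal group `SO(n)` into `SU(n)`, given by the
entrywise inclusion `ℝ → ℂ`. -/
def soToSU (n : ℕ) (A : ↥(SOr n)) : ↥(SU n) := by
  refine ⟨⟨Complex.ofRealHom.mapMatrix A.1.1, ?_, ?_⟩, ?_⟩
  · rw [star_mapMatrix, ← _root_.map_mul, A.1.2.1, _root_.map_one]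
  · rw [star_mapMatrix, ← _root_.map_mul, A.1.2.2, _root_.map_one]
  · have hdet : A.1.1.det = 1 := MonoidHom.mem_ker.mp A.2
    refine MonoidHom.mem_ker.mpr ?_
    show (Complex.ofRealHom.mapMatrix A.1.1).det = 1
    rw [← RingHom.map_det, hdet, _root_.map_one]

lemma continuous_soToSU (n : ℕ) : Continuous (soToSU n) := by
  apply Continuous.subtype_mk
  apply Continuous.subtype_mk
  apply continuous_matrix
  intro i j
  simp only [RingHom.mapMatrix_apply, Matrix.map_apply]
  exact Complex.continuous_ofReal.comp
    ((continuous_subtype_val.comp continuous_subtype_val).matrix_elem i j)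

/-- The inclusion `SO(n) ↪ SU(n)` as a continuous map. -/
def soEmbedding (n : ℕ) : C(↥(SOr n), ↥(SU n)) :=
  ⟨soToSU n, continuous_soToSU n⟩

lemma soEmbedding_one (n : ℕ) : soEmbedding n 1 = 1 := by
  apply Subtype.ext
  apply Subtype.ext
  show Complex.ofRealHom.mapMatrix (1 : Matrix (Fin n) (Fin n) ℝ) = 1
  rw [_root_.map_one]

/-- The map on homotopy groups induced by a pointed continuous map. -/
def HomotopyGroup.induced {X Y : Type*} [TopologicalSpace X] [TopologicalSpace Y]
    (N : Type*) (f : C(X, Y)) {x : X} {y : Y} (hf : f x = y) :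
    HomotopyGroup N X x → HomotopyGroup N Y y :=
  Quotient.map
    (fun g => ⟨f.comp g.1, fun z hz => by
      simp only [ContinuousMap.comp_apply]
      rw [g.2 z hz, hf]⟩)
    (fun a b hab => hab.map fun H => H.compContinuousMap f)

open scoped unitInterval Quaternion

namespace GenLoop

variable {ι X Y : Type*} [TopologicalSpace X] [TopologicalSpace Y] {x : X} {y : Y}

/-- Generalized loops joined by a continuous family of generalized loops are homotopic. -/
theorem homotopic_of_family {f g : Ω^ ι X x} (H : I × (ι → I) → X) (hH : Continuous H)
    (h0 : ∀ s, H (0, s) = f s) (h1 : ∀ s, H (1, s) = g s)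
    (hb : ∀ t, ∀ s ∈ Cube.boundary ι, H (t, s) = x) : Homotopic f g :=
  ⟨{ toFun := H
     continuous_toFun := hH
     map_zero_left := h0
     map_one_left := h1
     prop' := fun t s hs => (hb t s hs).trans (f.2 s hs).symm }⟩

/-- The class of a generalized loop in the homotopy group. -/
def homotopyClass (f : Ω^ ι X x) : HomotopyGroup ι X x :=
  ⟦f⟧

theorem Homotopic.homotopyClass_eq {f g : Ω^ ι X x} (H : Homotopic f g) :
    homotopyClass f = homotopyClass g :=
  Quotient.sound H

/-- The image of a generalized loop under a pointed continuous map. -/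
def map (h : C(X, Y)) (hxy : h x = y) (f : Ω^ ι X x) : Ω^ ι Y y :=
  ⟨h.comp f.1, fun s hs => by rw [ContinuousMap.comp_apply, f.2 s hs, hxy]⟩

@[simp]
theorem map_apply (h : C(X, Y)) (hxy : h x = y) (f : Ω^ ι X x) (s : ι → I) :
    map h hxy f s = h (f s) :=
  rfl

theorem Homotopic.map {f g : Ω^ ι X x} (H : Homotopic f g) (h : C(X, Y)) (hxy : h x = y) :
    Homotopic (GenLoop.map h hxy f) (GenLoop.map h hxy g) :=
  Nonempty.map (fun K => K.compContinuousMap h) H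

variable {G : Type*} [Monoid G] [TopologicalSpace G] [ContinuousMul G]

/-- The pointwise product of generalized loops in a topological monoid. -/
def pointwiseMul (f g : Ω^ ι G 1) : Ω^ ι G 1 :=
  ⟨f.1 * g.1, fun s hs => by rw [ContinuousMap.mul_apply, f.2 s hs, g.2 s hs, one_mul]⟩

@[simp]
theorem pointwiseMul_apply (f g : Ω^ ι G 1) (s : ι → I) : pointwiseMul f g s = f s * g s :=
  rfl

theorem Homotopic.pointwiseMul {f f' g g' : Ω^ ι G 1} (hf : Homotopic f f')
    (hg : Homotopic g g') : Homotopic (pointwiseMul f g) (pointwiseMul f' g') := by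
  obtain ⟨F⟩ := hf
  obtain ⟨K⟩ := hg
  refine homotopic_of_family (fun p => F p * K p) (by fun_prop) (fun s => ?_) (fun s => ?_)
    fun t s hs => ?_
  · rw [F.apply_zero, K.apply_zero]; rfl
  · rw [F.apply_one, K.apply_one]; rfl
  · rw [F.eq_fst t hs, K.eq_fst t hs, f.2 s hs, g.2 s hs, one_mul]

variable [DecidableEq ι] [Nonempty ι]

theorem homotopyClass_pointwiseMul (f g : Ω^ ι G 1) :
    homotopyClass (pointwiseMul f g) = homotopyClass f * homotopyClass g := by
  let i : ι := Classical.arbitrary ι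
  have hf : Homotopic (transAt i const f) f := by
    refine Quotient.exact (Eq.trans (HomotopyGroup.mul_spec (i := i)).symm ?_)
    exact mul_one (homotopyClass f)
  have hg : Homotopic (transAt i g const) g := by
    refine Quotient.exact (Eq.trans (HomotopyGroup.mul_spec (i := i)).symm ?_)
    exact one_mul (homotopyClass g)
  have key : pointwiseMul (transAt i const f) (transAt i g const) = transAt i g f := by
    ext s
    rw [pointwiseMul_apply]
    simp only [transAt, coe_copy]
    split_ifs <;> simp
  refine Eq.trans ?_ (HomotopyGroup.mul_spec (i := i)).symm
  rw [← key]
  exact Quotient.sound (hf.symm.pointwiseMul hg.symm)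

end GenLoop

/-- A map from a cube to the unit sphere of a normed space of large dimension is close to one that
takes the same value on the boundary and omits the antipode of that value. -/
theorem exists_unit_map_ne_neg {ι E : Type*} [Fintype ι] [NormedAddCommGroup E] [NormedSpace ℝ E]
    [FiniteDimensional ℝ E] (hE : Fintype.card ι + 1 < Module.finrank ℝ E)
    (g : C(ι → I, E)) (e : E) (hg : ∀ s, ‖g s‖ = 1) (he : ‖e‖ = 1)
    (hb : ∀ s ∈ Cube.boundary ι, g s = e) :
    ∃ g' : C(ι → I, E), (∀ s, ‖g' s‖ = 1) ∧ (∀ s ∈ Cube.boundary ι, g' s = e) ∧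
      (∀ s, g s + g' s ≠ 0) ∧ ∀ s, g' s + e ≠ 0 := by
  obtain ⟨p, hp, hpg, -⟩ := Continuous.exists_contDiff_approx (E := ι → ℝ) (F := E)
    (f := fun v => g fun i => Set.projIcc 0 1 zero_le_one (v i)) (ε := fun _ => 1 / 8) 1
    (by fun_prop) (by fun_prop) (by intro; norm_num)
  have hq : ContDiff ℝ 1 fun z : (ι → ℝ) × ℝ => p z.1 + z.2 • e := by
    have : ContDiff ℝ 1 p := hp
    fun_prop
  obtain ⟨c, hc, hc'⟩ :=
    (hq.dense_compl_range_of_finrank_lt_finrank (by simpa using hE)).exists_dist_lt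
    (0 : E) (ε := 1 / 8) (by norm_num)
  set u : (ι → I) → E := fun s => p (fun i => (s i : ℝ)) - c with hu
  have hu_cont : Continuous u := by
    have := hp.continuous
    fun_prop
  have hug : ∀ s, ‖u s - g s‖ ≤ 1 / 4 := by
    intro s
    have h1 := hpg fun i => (s i : ℝ)
    simp only [Set.projIcc_val, dist_eq_norm] at h1
    have h2 : ‖c‖ < 1 / 8 := by simpa using hc'
    calc ‖u s - g s‖ = ‖(p (fun i => (s i : ℝ)) - g s) - c‖ := by rw [hu, sub_right_comm]
      _ ≤ _ := norm_sub_le _ _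
      _ ≤ 1 / 4 := by linarith
  have hue : ∀ s (r : ℝ), u s ≠ r • e := by
    intro s r h
    apply hc
    refine ⟨(fun i => (s i : ℝ), -r), ?_⟩
    simp only [hu] at h
    simp only [neg_smul, ← h]
    abel
  set χ : (ι → I) → ℝ := fun s => min 1 (2 * ‖g s - e‖) with hχ
  have hχ_cont : Continuous χ := by fun_prop
  have hχ0 : ∀ s, 0 ≤ χ s := fun s => le_min zero_le_one (by positivity)
  have hχ1 : ∀ s, χ s ≤ 1 := fun s => min_le_left _ _
  set m : (ι → I) → E := fun s => g s + χ s • (u s - g s) with hm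
  have hm_cont : Continuous m := by fun_prop
  have hmg : ∀ s, ‖m s - g s‖ ≤ 1 / 4 := by
    intro s
    have : m s - g s = χ s • (u s - g s) := by simp [hm]
    rw [this, norm_smul, Real.norm_of_nonneg (hχ0 s)]
    exact (mul_le_of_le_one_left (norm_nonneg _) (hχ1 s)).trans (hug s)
  have hmn : ∀ s, 3 / 4 ≤ ‖m s‖ := by
    intro s
    have h1 : ‖g s‖ - ‖m s‖ ≤ ‖m s - g s‖ := by
      rw [norm_sub_rev]; exact norm_sub_norm_le _ _
    have := hmg s
    rw [hg] at h1
    linarith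
  have hpos : ∀ s, 0 < ‖m s‖ := fun s => by linarith [hmn s]
  -- a sum with the normalization of `m s` vanishes only if `m s` is a negative multiple
  have hneg : ∀ s v, ‖m s‖⁻¹ • m s + v = 0 → m s = -(‖m s‖ • v) := by
    intro s v h
    have h2 : ‖m s‖ • (‖m s‖⁻¹ • m s + v) = 0 := by rw [h, smul_zero]
    rw [smul_add, smul_inv_smul₀ (hpos s).ne'] at h2
    exact eq_neg_of_add_eq_zero_left h2
  have hfar : ∀ s v, ‖v‖ = 1 → m s = -(‖m s‖ • v) → 1 ≤ ‖m s - v‖ := by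
    intro s v hv h
    have : m s - v = -((‖m s‖ + 1) • v) := by
      conv_lhs => rw [h]
      module
    rw [this, norm_neg, norm_smul, hv, Real.norm_of_nonneg (by linarith [hpos s])]
    linarith [hpos s]
  refine ⟨⟨fun s => ‖m s‖⁻¹ • m s, ?_⟩, fun s => ?_, fun s hs => ?_, fun s h => ?_, fun s h => ?_⟩
  · exact (hm_cont.norm.inv₀ fun s => (hpos s).ne').smul hm_cont
  · simp [norm_smul, (hpos s).ne']
  · have : m s = e := by simp [hm, hχ, hb s hs]
    simp [this, he]
  · rw [add_comm] at h
    have := hfar s _ (hg s) (hneg s _ h)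
    linarith [hmg s]
  · have h1 := hneg s _ h
    rcases le_or_gt 1 (2 * ‖g s - e‖) with h2 | h2
    · have : m s = u s := by simp [hm, hχ, min_eq_left h2]
      rw [this, ← neg_smul] at h1
      exact hue s _ h1
    · have h3 := hfar s _ he h1
      have : ‖m s - e‖ ≤ ‖m s - g s‖ + ‖g s - e‖ := by
        simpa using norm_add_le (m s - g s) (g s - e)
      linarith [hmg s]

/-- The normalized segment from a unit vector to a non-antipodal one avoids the antipode. -/
theorem segment_ne_zero {E : Type*} [NormedAddCommGroup E] [NormedSpace ℝ E] {x y : E}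
    (hx : ‖x‖ = 1) (hy : ‖y‖ = 1) (hxy : x + y ≠ 0) {t : ℝ} (ht0 : 0 ≤ t) {r : ℝ} (hr : 0 ≤ r)
    (ht1 : t ≤ 1) : (1 - t) • x + t • y + r • x ≠ 0 := by
  intro h
  have h1 : t • y = -((1 - t + r) • x) := by
    rw [← sub_eq_zero, ← h]; module
  have h2 : t = 1 - t + r := by
    have := congrArg norm h1
    rwa [norm_neg, norm_smul, norm_smul, hx, hy, mul_one, mul_one, Real.norm_of_nonneg ht0,
      Real.norm_of_nonneg (by linarith)] at this
  rw [← h2, ← smul_neg] at h1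
  have ht : t ≠ 0 := by rintro rfl; linarith
  exact hxy (by rw [smul_right_injective E ht h1]; simp)

section Rotation

variable {n 𝕜 : Type*} [Fintype n] [RCLike 𝕜]

open scoped ComplexOrder in
theorem one_add_dotProduct_ne_zero {x y : n → 𝕜} (hx : star x ⬝ᵥ x = 1)
    (hy : star y ⬝ᵥ y = 1) (hxy : x + y ≠ 0) : 1 + star y ⬝ᵥ x ≠ 0 := by
  intro h
  have h2 : star x ⬝ᵥ y = star (star y ⬝ᵥ x) := star_dotProduct _ _
  apply hxy
  rw [← dotProduct_star_self_eq_zero]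
  have h1 : star y ⬝ᵥ x = -1 := by linear_combination h
  rw [star_add, add_dotProduct, dotProduct_add, dotProduct_add, hx, hy, h2, h1]
  simp

variable [DecidableEq n]

theorem one_sub_smul_vecMulVec_mem_unitaryGroup {w : n → 𝕜} {τ : 𝕜}
    (h : star τ + τ = star τ * τ * (star w ⬝ᵥ w)) :
    1 - τ • vecMulVec w (star w) ∈ unitaryGroup n 𝕜 := by
  rw [mem_unitaryGroup_iff', star_eq_conjTranspose]
  have h1 : (1 - τ • vecMulVec w (star w))ᴴ = 1 - star τ • vecMulVec w (star w) := by
    rw [conjTranspose_sub, conjTranspose_smul, conjTranspose_one, conjTranspose_vecMulVec,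
      star_star]
  have h2 : vecMulVec w (star w) * vecMulVec w (star w) =
      (star w ⬝ᵥ w) • vecMulVec w (star w) := by
    rw [vecMulVec_mul_vecMulVec, vecMulVec_smul]
  rw [h1]
  simp only [sub_mul, mul_sub, one_mul, mul_one, smul_mul_smul_comm, h2, smul_smul, ← h]
  module

/-- A unitary matrix moving the unit vector `x` to the unit vector `y`, which depends continuously
on `x` and `y` as long as they are not antipodal. -/
def unitaryTransvection (x y : n → 𝕜) : Matrix n n 𝕜 :=
  (1 - (1 + star y ⬝ᵥ x)⁻¹ • vecMulVec (x + y) (star (x + y))) *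
    (1 - (2 : 𝕜) • vecMulVec x (star x))

variable {x y : n → 𝕜}

theorem unitaryTransvection_mem (hx : star x ⬝ᵥ x = 1) (hy : star y ⬝ᵥ y = 1)
    (hxy : x + y ≠ 0) : unitaryTransvection x y ∈ unitaryGroup n 𝕜 := by
  have h1 := one_add_dotProduct_ne_zero hx hy hxy
  have h2 : star x ⬝ᵥ y = star (star y ⬝ᵥ x) := star_dotProduct _ _
  refine mul_mem (one_sub_smul_vecMulVec_mem_unitaryGroup ?_)
    (one_sub_smul_vecMulVec_mem_unitaryGroup ?_)
  · have h3 : star (1 + star y ⬝ᵥ x) ≠ 0 := star_ne_zero.mpr h1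
    rw [star_inv₀, star_add x y, add_dotProduct, dotProduct_add, dotProduct_add, hx, hy, h2]
    field_simp
    rw [star_add, star_one]
    ring
  · rw [hx]
    simp [star_ofNat]
    norm_num

theorem unitaryTransvection_mulVec (hx : star x ⬝ᵥ x = 1) (hy : star y ⬝ᵥ y = 1)
    (hxy : x + y ≠ 0) : unitaryTransvection x y *ᵥ x = y := by
  have h1 := one_add_dotProduct_ne_zero hx hy hxy
  have h2 : (1 - (2 : 𝕜) • vecMulVec x (star x)) *ᵥ x = -x := by
    rw [sub_mulVec, one_mulVec, smul_mulVec, vecMulVec_mulVec, hx]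
    simp; module
  rw [unitaryTransvection, ← mulVec_mulVec, h2, sub_mulVec, one_mulVec, smul_mulVec,
    vecMulVec_mulVec, star_add, add_dotProduct, dotProduct_neg, dotProduct_neg, hx,
    ← neg_add, op_smul_eq_smul, smul_smul, mul_neg, inv_mul_cancel₀ h1]
  module

theorem unitaryTransvection_self (hx : star x ⬝ᵥ x = 1) : unitaryTransvection x x = 1 := by
  have h2 : vecMulVec x (star x) * vecMulVec x (star x) = vecMulVec x (star x) := by
    rw [vecMulVec_mul_vecMulVec, vecMulVec_smul, hx, one_smul]
  have h3 : (1 + 1 : 𝕜)⁻¹ • vecMulVec (x + x) (star (x + x)) =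
      (2 : 𝕜) • vecMulVec x (star x) := by
    rw [← two_smul 𝕜 x, star_smul, star_ofNat, vecMulVec_smul, smul_vecMulVec]
    simp only [smul_smul]
    norm_num
  rw [unitaryTransvection, hx, h3]
  simp only [sub_mul, mul_sub, one_mul, mul_one, smul_mul_smul_comm, h2]
  module

theorem unitaryTransvection_mulVec_of_orthogonal {z : n → 𝕜} (hx : star x ⬝ᵥ z = 0)
    (hy : star y ⬝ᵥ z = 0) : unitaryTransvection x y *ᵥ z = z := by
  have h2 : (1 - (2 : 𝕜) • vecMulVec x (star x)) *ᵥ z = z := by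
    rw [sub_mulVec, one_mulVec, smul_mulVec, vecMulVec_mulVec, hx]
    simp
  rw [unitaryTransvection, ← mulVec_mulVec, h2, sub_mulVec, one_mulVec, smul_mulVec,
    vecMulVec_mulVec, star_add, add_dotProduct, hx, hy]
  simp

end Rotation

section Descent

variable {𝕜 : Type*} [RCLike 𝕜] {N : ℕ} {ι : Type*}

/-- The group of unitary matrices of determinant one over `ℝ` or `ℂ`. -/
def specialUnitary (𝕜 : Type*) [RCLike 𝕜] (N : ℕ) : Subgroup (unitaryGroup (Fin N) 𝕜) :=
  (detMonoidHom.comp (unitaryGroup (Fin N) 𝕜).subtype).ker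

namespace specialUnitary

theorem det_eq_one (M : specialUnitary 𝕜 N) : M.1.1.det = 1 :=
  MonoidHom.mem_ker.mp M.2

theorem star_mul_self (M : specialUnitary 𝕜 N) : star M.1.1 * M.1.1 = 1 :=
  mem_unitaryGroup_iff'.mp M.1.2

theorem star_col_dotProduct (M : specialUnitary 𝕜 N) (i j : Fin N) :
    (star fun l => M.1.1 l i) ⬝ᵥ (fun l => M.1.1 l j) = (1 : Matrix (Fin N) (Fin N) 𝕜) i j := by
  rw [← star_mul_self M]; rfl

/-- A continuous family of matrices in the special unitary group. -/
def ofMatrix {T : Type*} [TopologicalSpace T] (M : T → Matrix (Fin N) (Fin N) 𝕜)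
    (hM : Continuous M) (hu : ∀ t, M t ∈ unitaryGroup (Fin N) 𝕜) (hd : ∀ t, (M t).det = 1) :
    C(T, specialUnitary 𝕜 N) :=
  ⟨fun t => ⟨⟨M t, hu t⟩, MonoidHom.mem_ker.mpr (hd t)⟩, (hM.subtype_mk _).subtype_mk _⟩

@[simp]
theorem ofMatrix_apply {T : Type*} [TopologicalSpace T] (M : T → Matrix (Fin N) (Fin N) 𝕜)
    (hM : Continuous M) (hu : ∀ t, M t ∈ unitaryGroup (Fin N) 𝕜) (hd : ∀ t, (M t).det = 1)
    (t : T) : (ofMatrix M hM hu hd t).1.1 = M t :=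
  rfl

theorem ext_matrix {M M' : specialUnitary 𝕜 N} (h : M.1.1 = M'.1.1) : M = M' :=
  Subtype.ext (Subtype.ext h)

/-- The matrix `M` fixes the `i`-th standard basis vector. -/
def Fixes (M : specialUnitary 𝕜 N) (i : Fin N) : Prop :=
  ∀ j, M.1.1 j i = (1 : Matrix (Fin N) (Fin N) 𝕜) j i

theorem Fixes.row {M : specialUnitary 𝕜 N} {i : Fin N} (h : Fixes M i) (j : Fin N) :
    M.1.1 i j = (1 : Matrix (Fin N) (Fin N) 𝕜) i j := by
  have h1 := star_col_dotProduct M i j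
  have h2 : (star fun l => M.1.1 l i) = Pi.single i 1 := by
    ext l
    rw [Pi.star_apply, h l, Pi.single_apply, one_apply]
    split_ifs <;> simp
  rwa [h2, single_one_dotProduct] at h1

end specialUnitary

open specialUnitary

theorem norm_eq_one_iff_star_dotProduct {v : EuclideanSpace 𝕜 (Fin N)} :
    ‖v‖ = 1 ↔ star v.ofLp ⬝ᵥ v.ofLp = 1 := by
  have h : star v.ofLp ⬝ᵥ v.ofLp = ((‖v‖ : ℝ) : 𝕜) ^ 2 := by
    rw [← inner_self_eq_norm_sq_to_K (𝕜 := 𝕜) v, EuclideanSpace.inner_eq_star_dotProduct,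
      dotProduct_comm]
  rw [h]
  norm_cast
  exact (pow_eq_one_iff_of_nonneg (norm_nonneg _) two_ne_zero).symm

theorem exists_homotopic_col_eq {k l : Fin N} (hl : l < k) (f : Ω^ ι (specialUnitary 𝕜 N) 1)
    (hf : ∀ s i, k < i → Fixes (f s) i) (γ : C(ι → I, EuclideanSpace 𝕜 (Fin N)))
    (hγ : ∀ s, ‖γ s‖ = 1) (hsupp : ∀ s i, k < i → γ s i = 0)
    (hb : ∀ s ∈ Cube.boundary ι, γ s = EuclideanSpace.single k 1)
    (hne : ∀ s, WithLp.toLp 2 (fun j => (f s).1.1 j k) + γ s ≠ 0) :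
    ∃ f' : Ω^ ι (specialUnitary 𝕜 N) 1, GenLoop.Homotopic f f' ∧
      (∀ s i, k < i → Fixes (f' s) i) ∧ ∀ s j, (f' s).1.1 j k = γ s j := by
  have hfc : Continuous fun s => (f s).1.1 :=
    continuous_subtype_val.comp (continuous_subtype_val.comp f.1.continuous)
  set g : (ι → I) → EuclideanSpace 𝕜 (Fin N) :=
    fun s => WithLp.toLp 2 fun j => (f s).1.1 j k with hg
  have hgc : Continuous g := by
    refine (PiLp.continuous_toLp 2 _).comp (continuous_pi fun j => hfc.matrix_elem j k)
  have hg1 : ∀ s, ‖g s‖ = 1 := fun s => by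
    rw [norm_eq_one_iff_star_dotProduct]
    simpa using star_col_dotProduct (f s) k k
  have hgsupp : ∀ s i, k < i → g s i = 0 := fun s i hi => by
    simpa [one_apply, hi.ne'] using (hf s i hi).row k
  have hgb : ∀ s ∈ Cube.boundary ι, g s = EuclideanSpace.single k 1 := fun s hs => by
    ext j
    simp [hg, f.2 s hs, one_apply, ← GenLoop.coe_coe]
  -- the normalized segment
  set m : I × (ι → I) → EuclideanSpace 𝕜 (Fin N) :=
    fun p => (1 - (p.1 : ℝ)) • g p.2 + (p.1 : ℝ) • γ p.2 with hm
  have hmc : Continuous m := by fun_prop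
  have hmr : ∀ p, ∀ r : ℝ, 0 ≤ r → m p + r • g p.2 ≠ 0 := fun p r hr =>
    segment_ne_zero (hg1 p.2) (hγ p.2) (hne p.2) p.1.2.1 hr p.1.2.2
  have hm0 : ∀ p, m p ≠ 0 := fun p => by simpa using hmr p 0 le_rfl
  set y : I × (ι → I) → EuclideanSpace 𝕜 (Fin N) := fun p => ‖m p‖⁻¹ • m p with hy
  have hyc : Continuous y := (hmc.norm.inv₀ fun p => norm_ne_zero_iff.mpr (hm0 p)).smul hmc
  have hy1 : ∀ p, ‖y p‖ = 1 := fun p => by simp [hy, norm_smul, hm0 p]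
  have hgy : ∀ p, g p.2 + y p ≠ 0 := fun p h => by
    apply hmr p ‖m p‖ (norm_nonneg _)
    have : m p + ‖m p‖ • g p.2 = ‖m p‖ • (g p.2 + y p) := by
      rw [smul_add, hy, smul_inv_smul₀ (norm_ne_zero_iff.mpr (hm0 p)), add_comm]
    rw [this, h, smul_zero]
  have hysupp : ∀ p i, k < i → y p i = 0 := fun p i hi => by
    simp [hy, hm, hgsupp p.2 i hi, hsupp p.2 i hi]
  have hx' : ∀ s, star (g s).ofLp ⬝ᵥ (g s).ofLp = 1 := fun s =>
    norm_eq_one_iff_star_dotProduct.mp (hg1 s)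
  have hy' : ∀ p, star (y p).ofLp ⬝ᵥ (y p).ofLp = 1 := fun p =>
    norm_eq_one_iff_star_dotProduct.mp (hy1 p)
  have hxy' : ∀ p, (g p.2).ofLp + (y p).ofLp ≠ 0 := fun p h => by
    apply hgy p
    ext j
    exact congrFun h j
  set R : I × (ι → I) → Matrix (Fin N) (Fin N) 𝕜 :=
    fun p => unitaryTransvection (g p.2).ofLp (y p).ofLp with hR
  have hRu : ∀ p, R p ∈ unitaryGroup (Fin N) 𝕜 := fun p =>
    unitaryTransvection_mem (hx' p.2) (hy' p) (hxy' p)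
  have hgc' : Continuous fun p : I × (ι → I) => (g p.2).ofLp :=
    (PiLp.continuous_ofLp 2 _).comp (hgc.comp continuous_snd)
  have hyc' : Continuous fun p : I × (ι → I) => (y p).ofLp := (PiLp.continuous_ofLp 2 _).comp hyc
  have hRc : Continuous R := by
    have hc : Continuous fun p : I × (ι → I) => (1 + star (y p).ofLp ⬝ᵥ (g p.2).ofLp)⁻¹ :=
      (continuous_const.add (hyc'.star.dotProduct hgc')).inv₀ fun p =>
        one_add_dotProduct_ne_zero (hx' p.2) (hy' p) (hxy' p)
    have hc' : Continuous fun p : I × (ι → I) =>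
        (2 : 𝕜) • vecMulVec (g p.2).ofLp (star (g p.2).ofLp) :=
      (hgc'.matrix_vecMulVec hgc'.star).const_smul (2 : 𝕜)
    exact (continuous_const.sub (hc.smul ((hgc'.add hyc').matrix_vecMulVec
      (hgc'.add hyc').star))).matrix_mul (continuous_const.sub hc')
  have hRone : ∀ p, y p = g p.2 → R p = 1 := fun p h => by
    rw [hR]
    simp only [h]
    exact unitaryTransvection_self (hx' p.2)
  set D : I × (ι → I) → Matrix (Fin N) (Fin N) 𝕜 :=
    fun p => diagonal (Function.update 1 l (star (R p).det)) with hD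
  have hdet : ∀ p, (R p).det * star (R p).det = 1 := fun p =>
    (Unitary.mem_iff.mp (det_of_mem_unitary (hRu p))).2
  have hDu : ∀ p, D p ∈ unitaryGroup (Fin N) 𝕜 := fun p => by
    rw [mem_unitaryGroup_iff', star_eq_conjTranspose, diagonal_conjTranspose, diagonal_mul_diagonal,
      ← diagonal_one]
    congr 1
    ext i
    by_cases h : i = l
    · subst h; simpa using hdet p
    · simp [h]
  have hDc : Continuous D := (continuous_const.update l (hRc.matrix_det.star)).matrix_diagonal
  have hDd : ∀ p, (D p).det = star (R p).det := fun p => by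
    rw [hD, det_diagonal, Finset.prod_update_of_mem (Finset.mem_univ l)]
    simp
  have hDone : ∀ p, R p = 1 → D p = 1 := fun p h => by
    simp [hD, h]
  set K := specialUnitary.ofMatrix (fun p => R p * (f p.2).1.1 * D p)
    ((hRc.matrix_mul (hfc.comp continuous_snd)).matrix_mul hDc)
    (fun p => mul_mem (mul_mem (hRu p) (f p.2).1.2) (hDu p))
    (fun p => by rw [det_mul, det_mul, det_eq_one, hDd, mul_one, hdet]) with hK
  have hKone : ∀ p, y p = g p.2 → K p = f p.2 := fun p h => by
    apply ext_matrix
    rw [hK, ofMatrix_apply, hDone p (hRone p h), hRone p h, one_mul, mul_one]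
  have hKcol : ∀ p i j, i ≠ l → (K p).1.1 j i = (R p *ᵥ fun r => (f p.2).1.1 r i) j := by
    intro p i j hi
    rw [hK, ofMatrix_apply, hD, mul_diagonal]
    simp only [Function.update_of_ne hi, Pi.one_apply, mul_one]
    rfl
  have hyb : ∀ t, ∀ s ∈ Cube.boundary ι, y (t, s) = g s := fun t s hs => by
    have : m (t, s) = g s := by
      simp only [hm, hgb s hs, hb s hs]; module
    simp [hy, this, hg1]
  have hKb : ∀ t, ∀ s ∈ Cube.boundary ι, K (t, s) = 1 := fun t s hs =>
    (hKone _ (hyb t s hs)).trans (f.2 s hs)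
  refine ⟨⟨K.comp ⟨fun s => (1, s), by fun_prop⟩, fun s hs => hKb 1 s hs⟩,
    GenLoop.homotopic_of_family K K.continuous (fun s => ?_) (fun s => rfl) hKb,
    fun s i hi j => ?_, fun s j => ?_⟩
  · apply hKone
    simp [hy, hm, hg1]
  · refine (hKcol (1, s) i j (hl.trans hi).ne').trans ?_
    have h1 : (fun r => (f s).1.1 r i) = Pi.single i 1 := by
      ext r; rw [hf s i hi r, Pi.single_apply, one_apply]
    have h2 : R (1, s) *ᵥ Pi.single i 1 = Pi.single i 1 := by
      apply unitaryTransvection_mulVec_of_orthogonal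
      · simpa using hgsupp s i hi
      · simpa using hysupp (1, s) i hi
    rw [h1, h2, Pi.single_apply, one_apply]
  · refine (hKcol (1, s) k j hl.ne').trans ?_
    have h1 := unitaryTransvection_mulVec (hx' s) (hy' (1, s)) (hxy' (1, s))
    refine (congrFun h1 j).trans ?_
    simp [hy, hm, hγ]

end Descent

open specialUnitary

section Descent
variable {𝕜 : Type*} [RCLike 𝕜] {N : ℕ} {ι : Type*}

/-- The real subspace of vectors supported on the coordinates up to `k`. -/
def supportedUpTo (𝕜 : Type*) [RCLike 𝕜] {N : ℕ} (k : Fin N) :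
    Submodule ℝ (EuclideanSpace 𝕜 (Fin N)) where
  carrier := {v | ∀ i, k < i → v i = 0}
  add_mem' hv hw i hi := by simp [hv i hi, hw i hi]
  zero_mem' i _ := rfl
  smul_mem' r v hv i hi := by simp [hv i hi]

theorem finrank_mul_le_finrank_supportedUpTo (k : Fin N) :
    Module.finrank ℝ 𝕜 * (k + 1) ≤ Module.finrank ℝ (supportedUpTo 𝕜 k) := by
  let L : (Fin (k + 1) → 𝕜) →ₗ[ℝ] supportedUpTo 𝕜 k :=
    { toFun := fun v => ⟨WithLp.toLp 2 fun i =>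
          if h : i ≤ k then v ⟨i, Nat.lt_succ_of_le h⟩ else 0,
        fun i hi => dif_neg (not_le.mpr hi)⟩
      map_add' := fun v w => by
        ext i
        by_cases h : i ≤ k <;> simp [h]
      map_smul' := fun r v => by
        ext i
        by_cases h : i ≤ k
        · simp [h]
        · simp only [h]; simp [h] }
  have hL : Function.Injective L := fun v w h => by
    ext ⟨i, hi⟩
    have := congrArg (fun z : supportedUpTo 𝕜 k => z.1 ⟨i, by omega⟩) h
    have hi' : (⟨i, by omega⟩ : Fin N) ≤ k := Nat.le_of_lt_succ hi
    simpa [L, hi'] using this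
  have := LinearMap.finrank_le_finrank_of_injective hL
  rwa [Module.finrank_pi_fintype, Finset.sum_const, Finset.card_univ, Fintype.card_fin,
    smul_eq_mul, mul_comm] at this

variable [Fintype ι]

theorem exists_homotopic_fixes_le {k l : Fin N} (hl : l < k)
    (hk : Fintype.card ι + 1 < Module.finrank ℝ 𝕜 * (k + 1)) (f : Ω^ ι (specialUnitary 𝕜 N) 1)
    (hf : ∀ s i, k < i → Fixes (f s) i) :
    ∃ f' : Ω^ ι (specialUnitary 𝕜 N) 1, GenLoop.Homotopic f f' ∧
      ∀ s i, k ≤ i → Fixes (f' s) i := by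
  have hfc : Continuous fun s => (f s).1.1 :=
    continuous_subtype_val.comp (continuous_subtype_val.comp f.1.continuous)
  have hesupp : ∀ i, k < i → (EuclideanSpace.single k 1 : EuclideanSpace 𝕜 (Fin N)) i = 0 :=
    fun i hi => by simp [hi.ne']
  let e : supportedUpTo 𝕜 k := ⟨EuclideanSpace.single k 1, hesupp⟩
  let g : C(ι → I, supportedUpTo 𝕜 k) :=
    ⟨fun s => ⟨WithLp.toLp 2 fun j => (f s).1.1 j k, fun i hi => by
        simpa [one_apply, hi.ne'] using (hf s i hi).row k⟩,
      ((PiLp.continuous_toLp 2 _).comp (continuous_pi fun j => hfc.matrix_elem j k)).subtype_mk _⟩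
  obtain ⟨g', hg'1, hg'b, hgg', hg'e⟩ := exists_unit_map_ne_neg
    (hk.trans_le (finrank_mul_le_finrank_supportedUpTo k)) g e
    (fun s => by
      rw [Submodule.coe_norm, norm_eq_one_iff_star_dotProduct]
      exact (star_col_dotProduct (f s) k k).trans (by simp))
    (by simp [e])
    (fun s hs => by
      ext j
      simp [g, e, f.2 s hs, one_apply, ← GenLoop.coe_coe])
  obtain ⟨f₁, hff₁, hf₁, hf₁c⟩ := exists_homotopic_col_eq hl f hf
    ⟨fun s => (g' s).1, by fun_prop⟩ hg'1 (fun s => (g' s).2)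
    (fun s hs => congrArg Subtype.val (hg'b s hs)) (fun s h => hgg' s (Subtype.ext h))
  obtain ⟨f₂, hff₂, hf₂, hf₂c⟩ := exists_homotopic_col_eq hl f₁ hf₁
    (ContinuousMap.const _ (EuclideanSpace.single k 1)) (by simp) (fun _ => hesupp) (fun _ _ => rfl)
    (fun s h => hg'e s (Subtype.ext (by
      refine Eq.trans ?_ h
      ext j
      simp [hf₁c s j, e])))
  refine ⟨f₂, hff₁.trans hff₂, fun s i hi => ?_⟩
  rcases hi.lt_or_eq with h | rfl
  · exact hf₂ s i h
  · intro j
    simpa [one_apply, Pi.single_apply] using hf₂c s j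

theorem exists_homotopic_fixes {k : ℕ} (hk : 0 < k)
    (hdim : Fintype.card ι + 1 < Module.finrank ℝ 𝕜 * (k + 1))
    (f : Ω^ ι (specialUnitary 𝕜 N) 1) :
    ∃ f' : Ω^ ι (specialUnitary 𝕜 N) 1, GenLoop.Homotopic f f' ∧
      ∀ s (i : Fin N), k ≤ (i : ℕ) → Fixes (f' s) i := by
  suffices h : ∀ d : ℕ, ∀ f : Ω^ ι (specialUnitary 𝕜 N) 1,
      (∀ s (i : Fin N), k + d ≤ (i : ℕ) → Fixes (f s) i) →
      ∃ f' : Ω^ ι (specialUnitary 𝕜 N) 1, GenLoop.Homotopic f f' ∧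
        ∀ s (i : Fin N), k ≤ (i : ℕ) → Fixes (f' s) i from
    h N f fun s i hi => absurd i.2 (by omega)
  intro d
  induction d with
  | zero => exact fun f hf => ⟨f, .refl _, hf⟩
  | succ d ih =>
    intro f hf
    by_cases hN : k + d < N
    · obtain ⟨f₁, hff₁, hf₁⟩ := exists_homotopic_fixes_le (k := ⟨k + d, hN⟩)
        (l := ⟨0, by omega⟩) (by simp [Fin.lt_def]; omega)
        (hdim.trans_le (Nat.mul_le_mul_left _ (by simp))) f
        (fun s i hi => hf s i hi)
      obtain ⟨f₂, hff₂, hf₂⟩ := ih f₁ fun s i hi => hf₁ s i hi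
      exact ⟨f₂, hff₁.trans hff₂, hf₂⟩
    · exact ih f fun s i hi => absurd i.2 (by omega)

end Descent

section BlockEmbedding

variable {𝕜 : Type*} [RCLike 𝕜] {k : ℕ} {ι : Type*}

/-- The block diagonal matrix with blocks `B` and `1`. -/
def blockOne (m : ℕ) (B : Matrix (Fin k) (Fin k) 𝕜) : Matrix (Fin (k + m)) (Fin (k + m)) 𝕜 :=
  (fromBlocks B 0 0 1).submatrix finSumFinEquiv.symm finSumFinEquiv.symm

theorem blockOne_mul (m : ℕ) (B C : Matrix (Fin k) (Fin k) 𝕜) :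
    blockOne m (B * C) = blockOne m B * blockOne m C := by
  simp [blockOne, submatrix_mul_equiv, fromBlocks_multiply]

theorem blockOne_one (m : ℕ) : blockOne m (1 : Matrix (Fin k) (Fin k) 𝕜) = 1 := by
  simp [blockOne]

theorem star_blockOne (m : ℕ) (B : Matrix (Fin k) (Fin k) 𝕜) :
    star (blockOne m B) = blockOne m (star B) := by
  simp [blockOne, star_eq_conjTranspose, conjTranspose_submatrix, fromBlocks_conjTranspose]

theorem det_blockOne (m : ℕ) (B : Matrix (Fin k) (Fin k) 𝕜) : (blockOne m B).det = B.det := by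
  simp [blockOne, det_submatrix_equiv_self]

theorem blockOne_injective (m : ℕ) :
    Function.Injective (blockOne m : Matrix (Fin k) (Fin k) 𝕜 → _) := fun B C h => by
  ext i j
  simpa [blockOne] using congrFun (congrFun h (Fin.castAdd m i)) (Fin.castAdd m j)

/-- The block diagonal embedding of special unitary groups. -/
def blockEmbedding (𝕜 : Type*) [RCLike 𝕜] (k m : ℕ) :
    C(specialUnitary 𝕜 k, specialUnitary 𝕜 (k + m)) :=
  ofMatrix (fun B => blockOne m B.1.1)
    (((continuous_subtype_val.comp continuous_subtype_val).matrix_fromBlocks continuous_const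
      continuous_const continuous_const).matrix_submatrix _ _)
    (fun B => by
      rw [mem_unitaryGroup_iff', star_blockOne, ← blockOne_mul, star_mul_self, blockOne_one])
    (fun B => by rw [det_blockOne, det_eq_one])

theorem blockEmbedding_apply (m : ℕ) (B : specialUnitary 𝕜 k) :
    (blockEmbedding 𝕜 k m B).1.1 = blockOne m B.1.1 :=
  rfl

theorem blockEmbedding_mul (m : ℕ) (B C : specialUnitary 𝕜 k) :
    blockEmbedding 𝕜 k m (B * C) = blockEmbedding 𝕜 k m B * blockEmbedding 𝕜 k m C :=
  ext_matrix (blockOne_mul m B.1.1 C.1.1)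

theorem blockEmbedding_one (k m : ℕ) : blockEmbedding 𝕜 k m 1 = 1 :=
  ext_matrix (blockOne_one m)

theorem exists_map_blockEmbedding_eq {m : ℕ} (f : Ω^ ι (specialUnitary 𝕜 (k + m)) 1)
    (hf : ∀ s (i : Fin (k + m)), k ≤ (i : ℕ) → Fixes (f s) i) :
    ∃ g : Ω^ ι (specialUnitary 𝕜 k) 1,
      GenLoop.map (blockEmbedding 𝕜 k m) (blockEmbedding_one k m) g = f := by
  have hfc : Continuous fun s => (f s).1.1 :=
    continuous_subtype_val.comp (continuous_subtype_val.comp f.1.continuous)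
  set B : (ι → I) → Matrix (Fin k) (Fin k) 𝕜 :=
    fun s => (f s).1.1.submatrix (Fin.castAdd m) (Fin.castAdd m) with hB
  have hne : ∀ (i : Fin k) (j : Fin m), Fin.castAdd m i ≠ Fin.natAdd k j := fun i j h => by
    have := congrArg Fin.val h
    simp at this
    omega
  have key : ∀ s, blockOne m (B s) = (f s).1.1 := fun s => by
    have hl : ∀ (j : Fin m), k ≤ ((Fin.natAdd k j : Fin (k + m)) : ℕ) := fun j => by simp
    ext i j
    rw [← finSumFinEquiv.apply_symm_apply i, ← finSumFinEquiv.apply_symm_apply j]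
    rcases finSumFinEquiv.symm i with i | i <;> rcases finSumFinEquiv.symm j with j | j
    · simp [blockOne, hB]
    · have := hf s _ (hl j) (Fin.castAdd m i)
      simp [blockOne, this, one_apply, hne]
    · have := (hf s _ (hl i)).row (Fin.castAdd m j)
      simp [blockOne, this, one_apply, (hne _ _).symm]
    · have := hf s _ (hl j) (Fin.natAdd k i)
      simp [blockOne, this, one_apply]
  refine ⟨⟨ofMatrix B (hfc.matrix_submatrix _ _) (fun s => ?_) (fun s => ?_), fun s hs => ?_⟩, ?_⟩
  · rw [mem_unitaryGroup_iff']
    apply blockOne_injective m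
    rw [blockOne_mul, ← star_blockOne, key, star_mul_self, blockOne_one]
  · rw [← det_blockOne m, key, det_eq_one]
  · apply ext_matrix
    apply blockOne_injective m
    have hfs : f s = 1 := f.2 s hs
    rw [ofMatrix_apply, key, hfs]
    exact (blockOne_one m).symm
  · ext1 s
    exact ext_matrix (key s)

end BlockEmbedding

section Conjugation

variable {N : ℕ} {ι : Type*}

theorem exists_homotopic_conj {K : Matrix (Fin N) (Fin N) ℂ} (hK : star K = K) (hKK : K * K = 1)
    (f : Ω^ ι (specialUnitary ℂ N) 1) :
    ∃ g : Ω^ ι (specialUnitary ℂ N) 1, GenLoop.Homotopic f g ∧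
      ∀ s, (g s).1.1 = K * (f s).1.1 * K := by
  have hfc : Continuous fun s => (f s).1.1 :=
    continuous_subtype_val.comp (continuous_subtype_val.comp f.1.continuous)
  set z : I → ℂ := fun t => Complex.exp ((Real.pi * (t : ℝ) : ℝ) * Complex.I) with hz
  have hzc : Continuous z := by fun_prop
  have hzz : ∀ t, z t * star (z t) = 1 := fun t => by
    rw [Complex.star_def, Complex.mul_conj, Complex.normSq_eq_norm_sq,
      Complex.norm_exp_ofReal_mul_I]
    simp
  set U : I → Matrix (Fin N) (Fin N) ℂ :=
    fun t => ((1 + z t) / 2) • (1 : Matrix (Fin N) (Fin N) ℂ) + ((1 - z t) / 2) • K with hU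
  have hUc : Continuous U := by
    have h1 : Continuous fun t => (1 + z t) / 2 := by fun_prop
    have h2 : Continuous fun t => (1 - z t) / 2 := by fun_prop
    exact (h1.smul continuous_const).add (h2.smul continuous_const)
  have hU1 : ∀ t, U t * star (U t) = 1 := fun t => by
    have h : ∀ a b c d : ℂ, (a • (1 : Matrix (Fin N) (Fin N) ℂ) + b • K) *
        (c • (1 : Matrix (Fin N) (Fin N) ℂ) + d • K) =
        (a * c + b * d) • (1 : Matrix (Fin N) (Fin N) ℂ) + (a * d + b * c) • K := fun a b c d => by
      simp only [add_mul, mul_add, smul_mul_smul_comm, one_mul, mul_one, hKK, add_smul]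
      abel
    simp only [hU, star_add, star_smul, star_one, hK, h]
    have h1 := hzz t
    simp only [star_div₀, star_add, star_sub, star_one, star_ofNat]
    have e1 : (1 + z t) / 2 * ((1 + star (z t)) / 2) +
        (1 - z t) / 2 * ((1 - star (z t)) / 2) = 1 := by
      linear_combination h1 / 2
    have e2 : (1 + z t) / 2 * ((1 - star (z t)) / 2) +
        (1 - z t) / 2 * ((1 + star (z t)) / 2) = 0 := by
      linear_combination -h1 / 2
    rw [e1, e2, one_smul, zero_smul, add_zero]
  have hUm : ∀ t, U t ∈ unitaryGroup (Fin N) ℂ := fun t => mem_unitaryGroup_iff.mpr (hU1 t)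
  have hU0 : U 0 = 1 := by simp [hU, hz]
  have hUK : U 1 = K := by simp [hU, hz]
  set H := specialUnitary.ofMatrix (fun p : I × (ι → I) => U p.1 * (f p.2).1.1 * star (U p.1))
    (((hUc.comp continuous_fst).matrix_mul (hfc.comp continuous_snd)).matrix_mul
      (hUc.comp continuous_fst).star)
    (fun p => mul_mem (mul_mem (hUm p.1) (f p.2).1.2) (Unitary.star_mem (hUm p.1)))
    (fun p => by rw [det_mul_right_comm, hU1, one_mul, det_eq_one]) with hH
  have hb : ∀ t, ∀ s ∈ Cube.boundary ι, H (t, s) = 1 := fun t s hs => by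
    apply ext_matrix
    have hfs : f s = 1 := f.2 s hs
    rw [hH, ofMatrix_apply, hfs]
    exact (congrArg (· * star (U t)) (mul_one (U t))).trans (hU1 t)
  refine ⟨⟨H.comp ⟨fun s => (1, s), by fun_prop⟩, fun s hs => hb 1 s hs⟩,
    GenLoop.homotopic_of_family H H.continuous (fun s => ?_) (fun s => rfl) hb, fun s => ?_⟩
  · apply ext_matrix
    rw [hH, ofMatrix_apply, hU0, star_one, one_mul, mul_one]
  · exact (congrArg₂ (fun A B => A * (f s).1.1 * star B) hUK hUK).trans (by rw [hK])

end Conjugation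

section QuaternionRotation

/-- The matrix of left multiplication by a quaternion. -/
noncomputable def leftMulMatrix (q : ℍ[ℝ]) : Matrix (Fin 4) (Fin 4) ℝ :=
  !![q.re, -q.imI, -q.imJ, -q.imK;
     q.imI, q.re, -q.imK, q.imJ;
     q.imJ, q.imK, q.re, -q.imI;
     q.imK, -q.imJ, q.imI, q.re]

/-- The matrix of right multiplication by the conjugate of a quaternion. -/
noncomputable def rightMulMatrix (q : ℍ[ℝ]) : Matrix (Fin 4) (Fin 4) ℝ :=
  !![q.re, q.imI, q.imJ, q.imK;
     -q.imI, q.re, -q.imK, q.imJ;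
     -q.imJ, q.imK, q.re, -q.imI;
     -q.imK, -q.imJ, q.imI, q.re]

/-- The matrix of quaternionic conjugation. -/
noncomputable def conjugationMatrix : Matrix (Fin 4) (Fin 4) ℝ :=
  diagonal ![1, -1, -1, -1]

theorem conjugationMatrix_mul_self : conjugationMatrix * conjugationMatrix = 1 := by
  rw [conjugationMatrix, diagonal_mul_diagonal, ← diagonal_one]
  congr 1
  ext i
  fin_cases i <;> simp

theorem conjugationMatrix_mul_leftMulMatrix_mul (q : ℍ[ℝ]) :
    conjugationMatrix * leftMulMatrix q * conjugationMatrix = rightMulMatrix q := by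
  ext i j
  rw [conjugationMatrix, mul_diagonal, diagonal_mul]
  fin_cases i <;> fin_cases j <;> simp [leftMulMatrix, rightMulMatrix]

theorem leftMulMatrix_mul (p q : ℍ[ℝ]) :
    leftMulMatrix (p * q) = leftMulMatrix p * leftMulMatrix q := by
  ext i j
  rw [mul_apply, Fin.sum_univ_four]
  fin_cases i <;> fin_cases j <;> simp [leftMulMatrix] <;> ring

theorem leftMulMatrix_one : leftMulMatrix 1 = 1 := by
  ext i j
  fin_cases i <;> fin_cases j <;> simp [leftMulMatrix]

theorem leftMulMatrix_star (q : ℍ[ℝ]) : leftMulMatrix (star q) = star (leftMulMatrix q) := by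
  ext i j
  fin_cases i <;> fin_cases j <;> simp [leftMulMatrix, star_apply]

theorem continuous_leftMulMatrix : Continuous leftMulMatrix := by
  have h0 := Quaternion.continuous_re
  have h1 := Quaternion.continuous_imI
  have h2 := Quaternion.continuous_imJ
  have h3 := Quaternion.continuous_imK
  refine continuous_matrix fun i j => ?_
  fin_cases i <;> fin_cases j <;> simp [leftMulMatrix] <;> fun_prop

theorem sq_add_sq_eq_one_of_mem_unitary {q : ℍ[ℝ]} (hq : q ∈ unitary ℍ[ℝ]) :
    q.re * q.re + q.imI * q.imI + q.imJ * q.imJ + q.imK * q.imK = 1 := by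
  simpa using congrArg QuaternionAlgebra.re (Unitary.mem_iff.mp hq).1

theorem mem_unitary_of_norm_eq_one {q : ℍ[ℝ]} (hq : ‖q‖ = 1) : q ∈ unitary ℍ[ℝ] := by
  have : Quaternion.normSq q = 1 := by rw [Quaternion.normSq_eq_norm_mul_self, hq, one_mul]
  rw [Unitary.mem_iff, Quaternion.star_mul_self, Quaternion.self_mul_star, this]
  simp

theorem det_leftMulMatrix {q : ℍ[ℝ]} (hq : q ∈ unitary ℍ[ℝ]) : (leftMulMatrix q).det = 1 := by
  have h := sq_add_sq_eq_one_of_mem_unitary hq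
  rw [det_succ_row_zero, Fin.sum_univ_four]
  simp [leftMulMatrix, det_fin_three, Fin.succAbove]
  linear_combination (q.re * q.re + q.imI * q.imI + q.imJ * q.imJ + q.imK * q.imK + 1) * h

/-- Left multiplication of unit quaternions on `ℝ⁴`. -/
noncomputable def leftRotation : unitary ℍ[ℝ] →* specialUnitary ℝ 4 where
  toFun q := ⟨⟨leftMulMatrix q, mem_unitaryGroup_iff'.mpr (by
    rw [← leftMulMatrix_star, ← leftMulMatrix_mul, (Unitary.mem_iff.mp q.2).1, leftMulMatrix_one])⟩,
    MonoidHom.mem_ker.mpr (det_leftMulMatrix q.2)⟩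
  map_one' := ext_matrix leftMulMatrix_one
  map_mul' p q := ext_matrix (leftMulMatrix_mul p q)

theorem continuous_leftRotation : Continuous leftRotation :=
  ((continuous_leftMulMatrix.comp continuous_subtype_val).subtype_mk _).subtype_mk _

/-- Right multiplication by the conjugates of unit quaternions on `ℝ⁴`. -/
noncomputable def rightRotation : unitary ℍ[ℝ] →* specialUnitary ℝ 4 where
  toFun q := ⟨⟨conjugationMatrix * leftMulMatrix q * conjugationMatrix,
    have h : conjugationMatrix ∈ unitaryGroup (Fin 4) ℝ := by
      rw [mem_unitaryGroup_iff, ← conjugationMatrix_mul_self]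
      congr 1
      simp [conjugationMatrix, star_eq_conjTranspose]
    mul_mem (mul_mem h (leftRotation q).1.2) h⟩,
    MonoidHom.mem_ker.mpr (by
      change (conjugationMatrix * leftMulMatrix q * conjugationMatrix).det = 1
      rw [det_mul_right_comm, conjugationMatrix_mul_self, one_mul, det_leftMulMatrix q.2])⟩
  map_one' := ext_matrix (by
    change conjugationMatrix * leftMulMatrix 1 * conjugationMatrix = 1
    rw [leftMulMatrix_one, mul_one, conjugationMatrix_mul_self])
  map_mul' p q := ext_matrix (by
    change conjugationMatrix * leftMulMatrix (p * q) * conjugationMatrix =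
      (conjugationMatrix * leftMulMatrix p * conjugationMatrix) *
        (conjugationMatrix * leftMulMatrix q * conjugationMatrix)
    rw [leftMulMatrix_mul]
    calc _ = conjugationMatrix * leftMulMatrix p * 1 * leftMulMatrix q * conjugationMatrix := by
          simp only [mul_one, mul_assoc]
      _ = _ := by
          rw [← conjugationMatrix_mul_self]
          simp only [mul_assoc])

theorem rightRotation_apply (q : unitary ℍ[ℝ]) :
    (rightRotation q).1.1 = conjugationMatrix * leftMulMatrix q * conjugationMatrix :=
  rfl

theorem continuous_rightRotation : Continuous rightRotation :=
  (((continuous_const.matrix_mul (continuous_leftMulMatrix.comp continuous_subtype_val)).matrix_mul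
    continuous_const).subtype_mk _).subtype_mk _

theorem leftRotation_mul_rightRotation_comm (p q : unitary ℍ[ℝ]) :
    leftRotation p * rightRotation q = rightRotation q * leftRotation p := by
  apply ext_matrix
  change leftMulMatrix p * (rightRotation q).1.1 = (rightRotation q).1.1 * leftMulMatrix p
  rw [rightRotation_apply, conjugationMatrix_mul_leftMulMatrix_mul]
  ext i j
  rw [mul_apply, mul_apply, Fin.sum_univ_four, Fin.sum_univ_four]
  fin_cases i <;> fin_cases j <;> simp [leftMulMatrix, rightMulMatrix] <;> ring

/-- The `i`-th column of a real `4 × 4` matrix as a quaternion. -/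
noncomputable def quaternionCol (M : Matrix (Fin 4) (Fin 4) ℝ) (i : Fin 4) : ℍ[ℝ] :=
  ⟨M 0 i, M 1 i, M 2 i, M 3 i⟩

theorem continuous_quaternionCol (i : Fin 4) : Continuous fun M => quaternionCol M i :=
  Quaternion.linearIsometryEquivTuple.symm.continuous.comp
    ((PiLp.continuous_toLp 2 _).comp
      (continuous_pi fun l => (continuous_id.matrix_elem l i)))

theorem quaternionCol_leftMulMatrix_mul (q : ℍ[ℝ]) (M : Matrix (Fin 4) (Fin 4) ℝ) (i : Fin 4) :
    quaternionCol (leftMulMatrix q * M) i = q * quaternionCol M i := by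
  apply Quaternion.ext
  · rw [Quaternion.re_mul]
    simp [quaternionCol, leftMulMatrix, mul_apply, Fin.sum_univ_four]; ring
  · rw [Quaternion.imI_mul]
    simp [quaternionCol, leftMulMatrix, mul_apply, Fin.sum_univ_four]; ring
  · rw [Quaternion.imJ_mul]
    simp [quaternionCol, leftMulMatrix, mul_apply, Fin.sum_univ_four]; ring
  · rw [Quaternion.imK_mul]
    simp [quaternionCol, leftMulMatrix, mul_apply, Fin.sum_univ_four]; ring

theorem quaternionCol_rightMulMatrix_mul (q : ℍ[ℝ]) (M : Matrix (Fin 4) (Fin 4) ℝ) (i : Fin 4) :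
    quaternionCol (rightMulMatrix q * M) i = quaternionCol M i * star q := by
  apply Quaternion.ext
  · rw [Quaternion.re_mul]
    simp [quaternionCol, rightMulMatrix, mul_apply, Fin.sum_univ_four]; ring
  · rw [Quaternion.imI_mul]
    simp [quaternionCol, rightMulMatrix, mul_apply, Fin.sum_univ_four]; ring
  · rw [Quaternion.imJ_mul]
    simp [quaternionCol, rightMulMatrix, mul_apply, Fin.sum_univ_four]; ring
  · rw [Quaternion.imK_mul]
    simp [quaternionCol, rightMulMatrix, mul_apply, Fin.sum_univ_four]; ring

theorem specialUnitary.fixes_iff_quaternionCol {M : specialUnitary ℝ 4} {i : Fin 4} :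
    Fixes M i ↔ quaternionCol M.1.1 i = quaternionCol 1 i := by
  rw [Quaternion.ext_iff]
  exact ⟨fun h => ⟨h 0, h 1, h 2, h 3⟩, fun ⟨h0, h1, h2, h3⟩ j => by
    fin_cases j
    exacts [h0, h1, h2, h3]⟩

theorem specialUnitary.eq_one_of_fixes {M : specialUnitary ℝ 4} (h0 : Fixes M 0) (h1 : Fixes M 1)
    (h2 : Fixes M 2) : M = 1 := by
  have hd := det_eq_one M
  have h : M.1.1 = !![1, 0, 0, 0; 0, 1, 0, 0; 0, 0, 1, 0; 0, 0, 0, M.1.1 3 3] := by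
    ext i j
    have e0 : M.1.1 i 0 = _ := h0 i
    have e1 : M.1.1 i 1 = _ := h1 i
    have e2 : M.1.1 i 2 = _ := h2 i
    have r0 : M.1.1 0 j = _ := h0.row j
    have r1 : M.1.1 1 j = _ := h1.row j
    have r2 : M.1.1 2 j = _ := h2.row j
    clear hd h0 h1 h2
    fin_cases i <;> fin_cases j <;>
      first | exact e0 | exact e1 | exact e2 | exact r0 | exact r1 | exact r2 | rfl
  rw [h, det_succ_row_zero, Fin.sum_univ_four] at hd
  simp [det_fin_three, Fin.succAbove] at hd
  apply ext_matrix
  rw [h, hd]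
  ext i j
  fin_cases i <;> fin_cases j <;> rfl

end QuaternionRotation

section RotationFactorization

@[simp]
theorem re_quaternionCol (M : Matrix (Fin 4) (Fin 4) ℝ) (i : Fin 4) :
    (quaternionCol M i).re = M 0 i :=
  rfl

@[simp]
theorem imI_quaternionCol (M : Matrix (Fin 4) (Fin 4) ℝ) (i : Fin 4) :
    (quaternionCol M i).imI = M 1 i :=
  rfl

@[simp]
theorem imJ_quaternionCol (M : Matrix (Fin 4) (Fin 4) ℝ) (i : Fin 4) :
    (quaternionCol M i).imJ = M 2 i :=
  rfl

@[simp]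
theorem imK_quaternionCol (M : Matrix (Fin 4) (Fin 4) ℝ) (i : Fin 4) :
    (quaternionCol M i).imK = M 3 i :=
  rfl

theorem mul_one_sub_mul_of_mul_self_eq_neg_one {R : Type*} [Ring R] {x y : R} (hx : x * x = -1)
    (hy : y * y = -1) : x * (1 - x * y) = (1 - x * y) * y := by
  rw [mul_sub, sub_mul, ← mul_assoc, hx, mul_assoc, hy]
  noncomm_ring

theorem exists_unitary_conj {T : Type*} [TopologicalSpace T] {w : T → ℍ[ℝ]} (hw : Continuous w)
    (h0 : ∀ t, w t ≠ 0) :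
    ∃ u : C(T, unitary ℍ[ℝ]), ∀ t p q, q * w t = w t * p ↔ star (u t : ℍ[ℝ]) * q * u t = p := by
  refine ⟨⟨fun t => ⟨‖w t‖⁻¹ • w t, mem_unitary_of_norm_eq_one ?_⟩,
    ((hw.norm.inv₀ fun t => norm_ne_zero_iff.mpr (h0 t)).smul hw).subtype_mk _⟩, fun t p q => ?_⟩
  · rw [norm_smul, norm_inv, norm_norm, inv_mul_cancel₀ (norm_ne_zero_iff.mpr (h0 t))]
  · rw [ContinuousMap.coe_mk]
    generalize_proofs hm
    let u : unitary ℍ[ℝ] := ⟨‖w t‖⁻¹ • w t, hm⟩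
    change _ ↔ star (u : ℍ[ℝ]) * q * u = p
    have hr : ‖w t‖⁻¹ ≠ 0 := inv_ne_zero (norm_ne_zero_iff.mpr (h0 t))
    have h1 : star (u : ℍ[ℝ]) * q * u = p ↔ q * u = u * p := by
      constructor
      · rintro rfl
        rw [mul_assoc, ← mul_assoc (u : ℍ[ℝ]), (Unitary.mem_iff.mp u.2).2, one_mul]
      · intro h
        rw [mul_assoc, h, ← mul_assoc, (Unitary.mem_iff.mp u.2).1, one_mul]
    rw [h1]
    change _ ↔ q * (‖w t‖⁻¹ • w t) = (‖w t‖⁻¹ • w t) * p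
    rw [mul_smul_comm, smul_mul_assoc]
    exact (smul_right_injective _ hr).eq_iff.symm

theorem specialUnitary.normSq_quaternionCol (M : specialUnitary ℝ 4) (i : Fin 4) :
    M.1.1 0 i * M.1.1 0 i + M.1.1 1 i * M.1.1 1 i + M.1.1 2 i * M.1.1 2 i +
      M.1.1 3 i * M.1.1 3 i = 1 := by
  simpa [dotProduct, Fin.sum_univ_four] using star_col_dotProduct M i i

theorem specialUnitary.quaternionCol_mem_unitary (M : specialUnitary ℝ 4) (i : Fin 4) :
    quaternionCol M.1.1 i ∈ unitary ℍ[ℝ] := by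
  have h : Quaternion.normSq (quaternionCol M.1.1 i) = 1 := by
    rw [Quaternion.normSq_def']
    simp only [sq]
    exact normSq_quaternionCol M i
  rw [Unitary.mem_iff, Quaternion.star_mul_self, Quaternion.self_mul_star, h]
  simp

theorem specialUnitary.quaternionCol_mul_self {M : specialUnitary ℝ 4} (hM : Fixes M 0) {i : Fin 4}
    (hi : i ≠ 0) : quaternionCol M.1.1 i * quaternionCol M.1.1 i = -1 := by
  have h0 : M.1.1 0 i = 0 := by rw [hM.row i, one_apply_ne hi.symm]
  have h := normSq_quaternionCol M i
  rw [h0] at h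
  apply Quaternion.ext
  · simp [h0]
    linarith
  · simp [h0]
    ring
  · simp [h0]
    ring
  · simp [h0]
    ring

theorem quaternionCol_leftRotation_inv_mul (p : unitary ℍ[ℝ]) (M : specialUnitary ℝ 4) (i : Fin 4) :
    quaternionCol (leftRotation p⁻¹ * M).1.1 i = star (p : ℍ[ℝ]) * quaternionCol M.1.1 i :=
  quaternionCol_leftMulMatrix_mul (star (p : ℍ[ℝ])) M.1.1 i

theorem quaternionCol_rightRotation_inv_mul (p : unitary ℍ[ℝ]) (M : specialUnitary ℝ 4)
    (i : Fin 4) :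
    quaternionCol (rightRotation p⁻¹ * M).1.1 i = quaternionCol M.1.1 i * p := by
  have := quaternionCol_rightMulMatrix_mul (star (p : ℍ[ℝ])) M.1.1 i
  rw [← conjugationMatrix_mul_leftMulMatrix_mul, star_star] at this
  exact this

/-- For a rotation `M`, a quaternion whose normalization conjugates `i` to the rotated vector
`star (M 1) * M i` whenever it does not vanish. -/
noncomputable def axisQuaternion (M : Matrix (Fin 4) (Fin 4) ℝ) : ℍ[ℝ] :=
  1 - star (quaternionCol M 0) * quaternionCol M 1 * quaternionCol 1 1

/-- The rotations admitting an explicit factorization into left and right multiplications. -/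
def factorizable : Set (specialUnitary ℝ 4) :=
  {M | axisQuaternion M.1.1 ≠ 0 ∧
    star (quaternionCol M.1.1 0) * quaternionCol M.1.1 2 * axisQuaternion M.1.1 +
      axisQuaternion M.1.1 * quaternionCol 1 2 ≠ 0}

theorem continuous_axisQuaternion : Continuous axisQuaternion :=
  continuous_const.sub (((continuous_quaternionCol 0).star.mul (continuous_quaternionCol 1)).mul
    continuous_const)

theorem isOpen_factorizable : IsOpen factorizable := by
  have h : Continuous fun M : specialUnitary ℝ 4 => M.1.1 :=
    continuous_subtype_val.comp continuous_subtype_val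
  have ha := continuous_axisQuaternion
  have h0 := continuous_quaternionCol 0
  have h2 := continuous_quaternionCol 2
  refine (isOpen_ne_fun (ha.comp h) continuous_const).inter (isOpen_ne_fun
    (Continuous.comp (g := fun M => star (quaternionCol M 0) * quaternionCol M 2 *
      axisQuaternion M + axisQuaternion M * quaternionCol 1 2) ?_ h) continuous_const)
  exact ((h0.star.mul h2).mul ha).add (ha.mul continuous_const)

theorem quaternionCol_one_zero : quaternionCol 1 0 = 1 := by
  apply Quaternion.ext <;> simp

theorem one_mem_factorizable : 1 ∈ factorizable := by
  have h1 : axisQuaternion 1 = 1 + 1 := by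
    apply Quaternion.ext <;> simp [axisQuaternion, quaternionCol_one_zero]
  refine ⟨fun h => ?_, fun h => ?_⟩
  · change axisQuaternion 1 = 0 at h
    rw [h1] at h
    have := congrArg QuaternionAlgebra.re h
    simp only [Quaternion.re_add, Quaternion.re_one, Quaternion.re_zero] at this
    norm_num at this
  · change star (quaternionCol 1 0) * quaternionCol 1 2 * axisQuaternion 1 +
      axisQuaternion 1 * quaternionCol 1 2 = 0 at h
    rw [h1, quaternionCol_one_zero] at h
    have := congrArg QuaternionAlgebra.imJ h
    simp at this

theorem exists_eq_leftRotation_mul_rightRotation_of_factorizable {T : Type*} [TopologicalSpace T]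
    (f : C(T, specialUnitary ℝ 4)) (hf : ∀ t, f t ∈ factorizable) :
    ∃ a b : C(T, unitary ℍ[ℝ]), ∀ t, f t = leftRotation (a t) * rightRotation (b t) := by
  have hfc : Continuous fun t => (f t).1.1 :=
    continuous_subtype_val.comp (continuous_subtype_val.comp f.continuous)
  let q : C(T, unitary ℍ[ℝ]) := ⟨fun t => ⟨_, quaternionCol_mem_unitary (f t) 0⟩,
    ((continuous_quaternionCol 0).comp hfc).subtype_mk _⟩
  have hac : Continuous fun t => axisQuaternion (f t).1.1 := continuous_axisQuaternion.comp hfc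
  obtain ⟨u, hu⟩ := exists_unitary_conj hac fun t => (hf t).1
  let i : ℍ[ℝ] := quaternionCol 1 1
  let j : ℍ[ℝ] := quaternionCol 1 2
  have h1 : Fixes (1 : specialUnitary ℝ 4) 0 := fun _ => rfl
  have hii : i * i = -1 := quaternionCol_mul_self h1 (by decide)
  have hjj : j * j = -1 := quaternionCol_mul_self h1 (by decide)
  let x : T → ℍ[ℝ] := fun t => star (q t : ℍ[ℝ]) * quaternionCol (f t).1.1 1
  let z : T → ℍ[ℝ] := fun t => star (q t : ℍ[ℝ]) * quaternionCol (f t).1.1 2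
  let y : T → ℍ[ℝ] := fun t => star (u t : ℍ[ℝ]) * z t * u t
  have hyc : Continuous fun t => 1 - y t * j := by
    have h2 : Continuous fun t => quaternionCol (f t).1.1 2 := (continuous_quaternionCol 2).comp hfc
    have hu' : Continuous fun t => (u t : ℍ[ℝ]) := continuous_subtype_val.comp u.continuous
    have hq' : Continuous fun t => (q t : ℍ[ℝ]) := continuous_subtype_val.comp q.continuous
    exact continuous_const.sub ((((hu'.star.mul (hq'.star.mul h2)).mul hu')).mul continuous_const)
  have hy0 : ∀ t, 1 - y t * j ≠ 0 := fun t h => by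
    have h2 : y t = -j := by
      have : y t * j * j = j := by rw [← sub_eq_zero.mp h, one_mul]
      rw [mul_assoc, hjj, mul_neg_one] at this
      rw [← this, neg_neg]
    have h3 := (hu t (-j) (z t)).mpr h2
    apply (hf t).2
    change z t * _ + _ * j = 0
    rw [h3, mul_neg, neg_add_cancel]
  obtain ⟨v, hv⟩ := exists_unitary_conj hyc hy0
  refine ⟨q * u * v, u * v, fun t => ?_⟩
  set M₁ := leftRotation (q t)⁻¹ * f t with hM₁
  set M₂ := leftRotation (u t)⁻¹ * (rightRotation (u t)⁻¹ * M₁) with hM₂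
  set M₃ := leftRotation (v t)⁻¹ * (rightRotation (v t)⁻¹ * M₂) with hM₃
  have c₁ : ∀ l, quaternionCol M₁.1.1 l = star (q t : ℍ[ℝ]) * quaternionCol (f t).1.1 l :=
    quaternionCol_leftRotation_inv_mul _ _
  have c₂ : ∀ l, quaternionCol M₂.1.1 l = star (u t : ℍ[ℝ]) * quaternionCol M₁.1.1 l * u t :=
    fun l => by
      rw [hM₂, quaternionCol_leftRotation_inv_mul, quaternionCol_rightRotation_inv_mul, mul_assoc]
  have c₃ : ∀ l, quaternionCol M₃.1.1 l = star (v t : ℍ[ℝ]) * quaternionCol M₂.1.1 l * v t :=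
    fun l => by
      rw [hM₃, quaternionCol_leftRotation_inv_mul, quaternionCol_rightRotation_inv_mul, mul_assoc]
  have d₁ : quaternionCol M₁.1.1 0 = 1 := (c₁ 0).trans (Unitary.coe_star_mul_self (q t))
  have d₂ : quaternionCol M₂.1.1 0 = 1 := by
    rw [c₂, d₁, mul_one, Unitary.coe_star_mul_self]
  have d₃ : quaternionCol M₃.1.1 0 = 1 := by
    rw [c₃, d₂, mul_one, Unitary.coe_star_mul_self]
  have fix₁ : Fixes M₁ 0 := fixes_iff_quaternionCol.mpr (d₁.trans quaternionCol_one_zero.symm)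
  have fix₂ : Fixes M₂ 0 := fixes_iff_quaternionCol.mpr (d₂.trans quaternionCol_one_zero.symm)
  have fix₃ : Fixes M₃ 0 := fixes_iff_quaternionCol.mpr (d₃.trans quaternionCol_one_zero.symm)
  have hxx : x t * x t = -1 := by
    have := quaternionCol_mul_self fix₁ (i := 1) (by decide)
    rwa [c₁] at this
  have e₂ : quaternionCol M₂.1.1 1 = i := by
    rw [c₂, c₁]
    refine (hu t i (x t)).mp ?_
    exact mul_one_sub_mul_of_mul_self_eq_neg_one hxx hii
  have fix₂i : Fixes M₂ 1 := fixes_iff_quaternionCol.mpr e₂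
  have hyM : y t = quaternionCol M₂.1.1 2 := by
    rw [c₂, c₁]
  have hyy : y t * y t = -1 := by
    rw [hyM]
    exact quaternionCol_mul_self fix₂ (by decide)
  have hyi : y t * i = -(i * y t) := by
    have e0 : M₂.1.1 0 2 = 0 := fix₂.row 2
    have e1 : M₂.1.1 1 2 = 0 := fix₂i.row 2
    rw [hyM]
    apply Quaternion.ext <;> simp [i, e0, e1]
  have hij : i * j = -(j * i) := by
    apply Quaternion.ext <;> simp [i, j]
  have e₃ : quaternionCol M₃.1.1 1 = i := by
    rw [c₃, e₂]
    refine (hv t i i).mp ?_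
    have hji : j * i = -(i * j) := by rw [hij, neg_neg]
    have : y t * j * i = i * (y t * j) := by
      rw [mul_assoc (y t) j i, hji, mul_neg, ← mul_assoc (y t) i j, hyi, neg_mul, neg_neg,
        mul_assoc i]
    rw [mul_sub, sub_mul, mul_one, one_mul, this]
  have k₃ : quaternionCol M₃.1.1 2 = j := by
    rw [c₃, ← hyM]
    exact (hv t j (y t)).mp (mul_one_sub_mul_of_mul_self_eq_neg_one hyy hjj)
  have hM : M₃ = 1 := eq_one_of_fixes fix₃ (fixes_iff_quaternionCol.mpr e₃)
    (fixes_iff_quaternionCol.mpr k₃)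
  rw [hM₃, hM₂, hM₁] at hM
  simp only [map_inv, inv_mul_eq_iff_eq_mul, mul_one] at hM
  rw [hM, ← leftRotation_mul_rightRotation_comm (v t), ← mul_assoc (leftRotation (u t)),
    ← mul_assoc (rightRotation (u t)), ← map_mul, ← leftRotation_mul_rightRotation_comm,
    ContinuousMap.mul_apply, ContinuousMap.mul_apply, ContinuousMap.mul_apply]
  simp only [map_mul, mul_assoc]

end RotationFactorization

section CubeBoundary

variable {ι : Type*} {φ : (ι → I) → ℝ}

theorem eq_of_sq_eq_one_of_path (hφ : Continuous φ) (h : ∀ s ∈ Cube.boundary ι, φ s ^ 2 = 1)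
    {γ : I → ι → I} (hγ : Continuous γ) (hb : ∀ t, γ t ∈ Cube.boundary ι) :
    φ (γ 1) = φ (γ 0) := by
  have hc : ContinuousOn (fun t => φ (γ t)) Set.univ := (hφ.comp hγ).continuousOn
  rcases isPreconnected_univ.eq_one_or_eq_neg_one_of_sq_eq hc
    (fun t _ => h _ (hb t)) with h | h
  · exact (h (Set.mem_univ 1)).trans (h (Set.mem_univ 0)).symm
  · exact (h (Set.mem_univ 1)).trans (h (Set.mem_univ 0)).symm

theorem eq_apply_zero_of_sq_eq_one_on_boundary [DecidableEq ι] [Nontrivial ι] (hφ : Continuous φ)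
    (h : ∀ s ∈ Cube.boundary ι, φ s ^ 2 = 1) {s : ι → I} (hs : s ∈ Cube.boundary ι) :
    φ s = φ 0 := by
  have key : ∀ s : ι → I, (∃ i, s i = 0) → φ s = φ 0 := by
    rintro s ⟨i, hi⟩
    have := eq_of_sq_eq_one_of_path hφ h (γ := fun t i => t * s i) (by fun_prop)
      fun t => ⟨i, Or.inl (by simp [hi])⟩
    simp only [one_mul, zero_mul] at this
    exact this
  obtain ⟨i, hi | hi⟩ := hs
  · exact key s ⟨i, hi⟩
  · obtain ⟨j, hj⟩ := exists_ne i
    have := eq_of_sq_eq_one_of_path hφ h (γ := fun t => Function.update s j (t * s j))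
      (by fun_prop) fun t => ⟨i, Or.inr (by rw [Function.update_of_ne hj.symm, hi])⟩
    rw [one_mul, Function.update_eq_self] at this
    rw [this]
    exact key _ ⟨j, by simp⟩

end CubeBoundary

section RotationLift

variable {T : Type*} [TopologicalSpace T]

/-- A family of rotations admitting a continuous factorization into left and right
multiplications by unit quaternions. -/
def IsFactored (g : T → specialUnitary ℝ 4) : Prop :=
  ∃ a b : C(T, unitary ℍ[ℝ]), ∀ t, g t = leftRotation (a t) * rightRotation (b t)

theorem leftRotation_mul_rightRotation_mul (a b c d : unitary ℍ[ℝ]) :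
    leftRotation a * rightRotation b * (leftRotation c * rightRotation d) =
      leftRotation (a * c) * rightRotation (b * d) := by
  rw [map_mul, map_mul, mul_assoc, ← mul_assoc (rightRotation b),
    ← leftRotation_mul_rightRotation_comm, mul_assoc, mul_assoc]

theorem IsFactored.mul {g h : T → specialUnitary ℝ 4} (hg : IsFactored g) (hh : IsFactored h) :
    IsFactored fun t => g t * h t := by
  obtain ⟨a, b, hab⟩ := hg
  obtain ⟨c, d, hcd⟩ := hh
  exact ⟨a * c, b * d, fun t => by
    simp only [hab, hcd, leftRotation_mul_rightRotation_mul]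
    rfl⟩

theorem IsFactored.inv {g : T → specialUnitary ℝ 4} (hg : IsFactored g) :
    IsFactored fun t => (g t)⁻¹ := by
  obtain ⟨a, b, hab⟩ := hg
  exact ⟨a⁻¹, b⁻¹, fun t => by
    simp only [hab]
    rw [leftRotation_mul_rightRotation_comm, _root_.mul_inv_rev, ← map_inv leftRotation,
      ← map_inv rightRotation]
    rfl⟩

theorem isLocallyConstant_isFactored [CompactSpace T] {F : I × T → specialUnitary ℝ 4}
    (hF : Continuous F) : IsLocallyConstant fun s : I => IsFactored fun t => F (s, t) := by
  refine (IsLocallyConstant.iff_eventually_eq _).mpr fun s₀ => ?_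
  have h : ∀ᶠ s in 𝓝 s₀, ∀ t ∈ (Set.univ : Set T), (F (s₀, t))⁻¹ * F (s, t) ∈ factorizable := by
    refine isCompact_univ.eventually_forall_of_forall_eventually fun t _ => ?_
    have hc : Continuous fun p : I × T => (F (s₀, p.2))⁻¹ * F p := by fun_prop
    refine hc.continuousAt.eventually (isOpen_factorizable.mem_nhds ?_)
    simp only [inv_mul_cancel]
    exact one_mem_factorizable
  filter_upwards [h] with s hs
  have hd : IsFactored fun t => (F (s₀, t))⁻¹ * F (s, t) :=
    exists_eq_leftRotation_mul_rightRotation_of_factorizable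
      ⟨fun t => (F (s₀, t))⁻¹ * F (s, t), by fun_prop⟩ fun t => hs t (Set.mem_univ t)
  refine propext ⟨fun h => ?_, fun h => ?_⟩
  · simpa using h.mul hd.inv
  · simpa using h.mul hd

theorem isFactored_of_homotopy [CompactSpace T] {F : I × T → specialUnitary ℝ 4}
    (hF : Continuous F) (h0 : ∀ t, F (0, t) = 1) : IsFactored fun t => F (1, t) := by
  refine (isLocallyConstant_isFactored hF).apply_eq_of_preconnectedSpace 0 1 ▸ ?_
  exact ⟨1, 1, fun t => by simp [h0]⟩

theorem eq_and_eq_re_of_leftRotation_mul_rightRotation_eq_one {a b : unitary ℍ[ℝ]}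
    (h : leftRotation a * rightRotation b = 1) :
    a = b ∧ (a : ℍ[ℝ]) = ((a : ℍ[ℝ]).re : ℍ[ℝ]) ∧ (a : ℍ[ℝ]).re ^ 2 = 1 := by
  have hc : ∀ i, (a : ℍ[ℝ]) * (quaternionCol 1 i * star (b : ℍ[ℝ])) = quaternionCol 1 i := by
    intro i
    have h1 : leftMulMatrix a * (rightRotation b).1.1 = 1 :=
      congrArg (fun M : specialUnitary ℝ 4 => M.1.1) h
    rw [rightRotation_apply, conjugationMatrix_mul_leftMulMatrix_mul] at h1
    rw [← quaternionCol_rightMulMatrix_mul, mul_one, ← quaternionCol_leftMulMatrix_mul, h1]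
  have hab : a = b := by
    have h0 := hc 0
    rw [quaternionCol_one_zero, one_mul] at h0
    apply Subtype.ext
    calc (a : ℍ[ℝ]) = a * (star (b : ℍ[ℝ]) * b) := by rw [(Unitary.mem_iff.mp b.2).1, mul_one]
      _ = b := by rw [← mul_assoc, h0, one_mul]
  subst hab
  have hcomm : ∀ i, (a : ℍ[ℝ]) * quaternionCol 1 i = quaternionCol 1 i * a := by
    intro i
    nth_rewrite 2 [← hc i]
    rw [mul_assoc, mul_assoc, (Unitary.mem_iff.mp a.2).1, mul_one]
  have h1 := hcomm 1
  have h2 := hcomm 2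
  have e1 := congrArg QuaternionAlgebra.imK h2
  have e2 := congrArg QuaternionAlgebra.imK h1
  have e3 := congrArg QuaternionAlgebra.imJ h1
  simp at e1 e2 e3
  have z1 : (a : ℍ[ℝ]).imI = 0 := by linarith
  have z2 : (a : ℍ[ℝ]).imJ = 0 := by linarith
  have z3 : (a : ℍ[ℝ]).imK = 0 := by linarith
  refine ⟨rfl, Quaternion.ext _ _ rfl z1 z2 z3, ?_⟩
  have := sq_add_sq_eq_one_of_mem_unitary a.2
  rw [z1, z2, z3] at this
  linarith

theorem exists_eq_pointwiseMul_map_rotation {ι : Type*} [DecidableEq ι] [Nontrivial ι]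
    (f : Ω^ ι (specialUnitary ℝ 4) 1) :
    ∃ p q : Ω^ ι (unitary ℍ[ℝ]) 1,
      f = GenLoop.pointwiseMul
        (GenLoop.map ⟨leftRotation, continuous_leftRotation⟩ (map_one leftRotation) p)
        (GenLoop.map ⟨rightRotation, continuous_rightRotation⟩ (map_one rightRotation) q) := by
  have h0b : (0 : ι → I) ∈ Cube.boundary ι := ⟨Classical.arbitrary ι, Or.inl rfl⟩
  obtain ⟨a, b, hab⟩ : IsFactored f := by
    have hF : Continuous fun p : I × (ι → I) => f fun i => p.1 * p.2 i :=
      f.1.continuous.comp (by fun_prop)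
    have := isFactored_of_homotopy hF fun t => by
      simp only [zero_mul]
      exact f.2 0 h0b
    simpa only [one_mul] using this
  have hb : ∀ s ∈ Cube.boundary ι, a s = b s ∧ (a s : ℍ[ℝ]) = ((a s : ℍ[ℝ]).re : ℍ[ℝ]) ∧
      (a s : ℍ[ℝ]).re ^ 2 = 1 := fun s hs =>
    eq_and_eq_re_of_leftRotation_mul_rightRotation_eq_one ((hab s).symm.trans (f.2 s hs))
  have ha : ∀ s ∈ Cube.boundary ι, a s = a 0 := fun s hs => by
    apply Subtype.ext
    have hc : Continuous fun s => (a s : ℍ[ℝ]).re :=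
      Quaternion.continuous_re.comp (continuous_subtype_val.comp a.continuous)
    rw [(hb s hs).2.1, (hb 0 h0b).2.1,
      eq_apply_zero_of_sq_eq_one_on_boundary hc (fun s hs => (hb s hs).2.2) hs]
  refine ⟨⟨⟨fun s => (a 0)⁻¹ * a s, by fun_prop⟩, fun s hs => ?_⟩,
    ⟨⟨fun s => (a 0)⁻¹ * b s, by fun_prop⟩, fun s hs => ?_⟩, ?_⟩
  · change (a 0)⁻¹ * a s = 1
    rw [ha s hs, inv_mul_cancel]
  · change (a 0)⁻¹ * b s = 1
    rw [← (hb s hs).1, ha s hs, inv_mul_cancel]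
  · ext1 s
    change f s = leftRotation ((a 0)⁻¹ * a s) * rightRotation ((a 0)⁻¹ * b s)
    have h1 : leftRotation (a 0) * rightRotation (a 0) = 1 := by
      have := (hab 0).symm.trans (f.2 0 h0b)
      rwa [← (hb 0 h0b).1] at this
    have h2 : leftRotation (a 0)⁻¹ * rightRotation (a 0)⁻¹ = 1 := by
      rw [map_inv, map_inv, ← _root_.mul_inv_rev, ← leftRotation_mul_rightRotation_comm, h1,
        inv_one]
    rw [← leftRotation_mul_rightRotation_mul, h2, one_mul, hab s]

end RotationLift

section ComplexRotation

/-- The complex `2 × 2` matrix of a quaternion. -/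
noncomputable def complexMatrix (q : ℍ[ℝ]) : Matrix (Fin 2) (Fin 2) ℂ :=
  !![⟨q.re, q.imI⟩, ⟨-q.imJ, -q.imK⟩; ⟨q.imJ, -q.imK⟩, ⟨q.re, -q.imI⟩]

theorem continuous_complexMatrix : Continuous complexMatrix := by
  have hc : ∀ {a b : ℍ[ℝ] → ℝ}, Continuous a → Continuous b →
      Continuous fun q => (⟨a q, b q⟩ : ℂ) := fun ha hb =>
    Complex.equivRealProdCLM.symm.continuous.comp (ha.prodMk hb)
  have h0 := Quaternion.continuous_re
  have h1 := Quaternion.continuous_imI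
  have h2 := Quaternion.continuous_imJ
  have h3 := Quaternion.continuous_imK
  refine continuous_matrix fun i j => ?_
  fin_cases i <;> fin_cases j
  exacts [hc h0 h1, hc h2.neg h3.neg, hc h2 h3.neg, hc h0 h1.neg]

/-- The identification of the unit quaternions with `SU(2)`. -/
noncomputable def unitaryQuaternionToSU : C(unitary ℍ[ℝ], specialUnitary ℂ 2) :=
  ofMatrix (fun q => complexMatrix q) (continuous_complexMatrix.comp continuous_subtype_val)
    (fun q => by
      have h := sq_add_sq_eq_one_of_mem_unitary q.2
      rw [mem_unitaryGroup_iff']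
      ext i j
      fin_cases i <;> fin_cases j <;>
        simp [complexMatrix, mul_apply, Complex.ext_iff, star_apply] <;>
        refine ⟨?_, ?_⟩ <;> linarith)
    (fun q => by
      have h := sq_add_sq_eq_one_of_mem_unitary q.2
      simp [complexMatrix, det_fin_two, Complex.ext_iff]
      refine ⟨?_, ?_⟩ <;> linarith)

theorem unitaryQuaternionToSU_apply (q : unitary ℍ[ℝ]) :
    (unitaryQuaternionToSU q).1.1 = complexMatrix q :=
  rfl

theorem unitaryQuaternionToSU_one : unitaryQuaternionToSU 1 = 1 := by
  apply ext_matrix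
  rw [unitaryQuaternionToSU_apply]
  ext i j
  fin_cases i <;> fin_cases j <;> simp [complexMatrix, Complex.ext_iff]

theorem specialUnitary.col_one_eq (M : specialUnitary ℂ 2) :
    M.1.1 1 1 = star (M.1.1 0 0) ∧ M.1.1 0 1 = -star (M.1.1 1 0) := by
  have hd := det_eq_one M
  rw [det_fin_two] at hd
  have h0 := star_col_dotProduct M 0 0
  have h1 := star_col_dotProduct M 0 1
  simp [dotProduct, Fin.sum_univ_two] at h0 h1
  refine ⟨?_, ?_⟩ <;> simp only [Complex.star_def]
  · linear_combination M.1.1 1 0 * h1 + starRingEnd ℂ (M.1.1 0 0) * hd - M.1.1 1 1 * h0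
  · linear_combination M.1.1 0 0 * h1 - starRingEnd ℂ (M.1.1 1 0) * hd - M.1.1 0 1 * h0

theorem exists_map_unitaryQuaternionToSU_eq {ι : Type*} (f : Ω^ ι (specialUnitary ℂ 2) 1) :
    ∃ q : Ω^ ι (unitary ℍ[ℝ]) 1,
      GenLoop.map unitaryQuaternionToSU unitaryQuaternionToSU_one q = f := by
  have hfc : ∀ i j, Continuous fun s => (f s).1.1 i j := fun i j =>
    (continuous_subtype_val.comp (continuous_subtype_val.comp f.1.continuous)).matrix_elem i j
  let Q : (ι → I) → ℍ[ℝ] := fun s =>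
    ⟨((f s).1.1 0 0).re, ((f s).1.1 0 0).im, ((f s).1.1 1 0).re, -((f s).1.1 1 0).im⟩
  have hQ : Continuous Q := Quaternion.linearIsometryEquivTuple.symm.continuous.comp
    ((PiLp.continuous_toLp 2 _).comp (f := fun s => ![((f s).1.1 0 0).re, ((f s).1.1 0 0).im,
      ((f s).1.1 1 0).re, -((f s).1.1 1 0).im]) (continuous_pi fun l => by
      have h0 := hfc 0 0
      have h1 := hfc 1 0
      fin_cases l
      exacts [Complex.continuous_re.comp h0, Complex.continuous_im.comp h0,
        Complex.continuous_re.comp h1, (Complex.continuous_im.comp h1).neg]))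
  have hu : ∀ s, Q s ∈ unitary ℍ[ℝ] := fun s => by
    have h := star_col_dotProduct (f s) 0 0
    have h' := congrArg Complex.re h
    simp [dotProduct, Fin.sum_univ_two] at h'
    have h : Quaternion.normSq (Q s) = 1 := by
      rw [Quaternion.normSq_def']
      simp only [Q]
      linarith
    rw [Unitary.mem_iff, Quaternion.star_mul_self, Quaternion.self_mul_star, h]
    simp
  refine ⟨⟨⟨fun s => ⟨Q s, hu s⟩, hQ.subtype_mk _⟩, fun s hs => ?_⟩, ?_⟩
  · have hfs : f s = 1 := f.2 s hs
    apply Subtype.ext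
    change Q s = 1
    apply Quaternion.ext <;> simp [Q, hfs]
  · ext1 s
    apply ext_matrix
    change complexMatrix (Q s) = _
    have h := col_one_eq (f s)
    ext i j
    fin_cases i <;> fin_cases j <;> simp [complexMatrix, Q, Complex.ext_iff, h]

/-- A Hermitian involution diagonalizing left multiplication by quaternions. -/
noncomputable def hermitianInvolution : Matrix (Fin 4) (Fin 4) ℂ :=
  ((√2 : ℝ) : ℂ)⁻¹ • !![1, Complex.I, 0, 0; -Complex.I, -1, 0, 0;
    0, 0, 1, -Complex.I; 0, 0, Complex.I, -1]

theorem star_hermitianInvolution : star hermitianInvolution = hermitianInvolution := by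
  rw [hermitianInvolution, star_smul]
  congr 1
  · simp
  · ext i j
    fin_cases i <;> fin_cases j <;> simp [star_apply]

theorem hermitianInvolution_mul_mul (M : Matrix (Fin 4) (Fin 4) ℂ) :
    hermitianInvolution * M * hermitianInvolution = (2⁻¹ : ℂ) •
      (!![1, Complex.I, 0, 0; -Complex.I, -1, 0, 0; 0, 0, 1, -Complex.I; 0, 0, Complex.I, -1] * M *
      !![1, Complex.I, 0, 0; -Complex.I, -1, 0, 0;
        0, 0, 1, -Complex.I; 0, 0, Complex.I, -1]) := by
  have h : ((√2 : ℝ) : ℂ)⁻¹ * ((√2 : ℝ) : ℂ)⁻¹ = 2⁻¹ := by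
    rw [← mul_inv, ← Complex.ofReal_mul, Real.mul_self_sqrt (by norm_num)]
    norm_num
  rw [hermitianInvolution, smul_mul_assoc, smul_mul_assoc, mul_smul_comm, smul_smul, h]

theorem hermitianInvolution_mul_self : hermitianInvolution * hermitianInvolution = 1 := by
  have := hermitianInvolution_mul_mul 1
  rw [mul_one, mul_one] at this
  rw [this]
  ext i j
  rw [Matrix.smul_apply, mul_apply, Fin.sum_univ_four]
  fin_cases i <;> fin_cases j <;> simp <;> norm_num

theorem star_swap_eq (i j : Fin 4) : star (swap ℂ i j) = swap ℂ i j := by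
  rw [star_eq_conjTranspose, conjTranspose_swap]

theorem swap_mul_mul_swap (i j : Fin 4) (M : Matrix (Fin 4) (Fin 4) ℂ) :
    swap ℂ i j * M * swap ℂ i j = M.submatrix (Equiv.swap i j) (Equiv.swap i j) := by
  simp [swap, PEquiv.toMatrix_toPEquiv_mul, PEquiv.mul_toMatrix_toPEquiv]

theorem blockOne_two_eq (B : Matrix (Fin 2) (Fin 2) ℂ) :
    blockOne 2 B = !![B 0 0, B 0 1, 0, 0; B 1 0, B 1 1, 0, 0; 0, 0, 1, 0; 0, 0, 0, 1] := by
  ext i j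
  fin_cases i <;> fin_cases j <;> rfl

theorem hermitianInvolution_mul_leftMulMatrix_mul (q : ℍ[ℝ]) :
    hermitianInvolution * (leftMulMatrix q).map Complex.ofReal * hermitianInvolution =
      (swap ℂ 1 2 * blockOne 2 (complexMatrix q) * swap ℂ 1 2) *
        (swap ℂ 0 3 * blockOne 2 (complexMatrix q) * swap ℂ 0 3) := by
  have h1 : swap ℂ 1 2 * blockOne 2 (complexMatrix q) * swap ℂ 1 2 =
      !![⟨q.re, q.imI⟩, 0, ⟨-q.imJ, -q.imK⟩, 0; 0, 1, 0, 0;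
        ⟨q.imJ, -q.imK⟩, 0, ⟨q.re, -q.imI⟩, 0; 0, 0, 0, 1] := by
    rw [swap_mul_mul_swap, blockOne_two_eq]
    ext i j
    fin_cases i <;> fin_cases j <;> rfl
  have h2 : swap ℂ 0 3 * blockOne 2 (complexMatrix q) * swap ℂ 0 3 =
      !![1, 0, 0, 0; 0, ⟨q.re, -q.imI⟩, 0, ⟨q.imJ, -q.imK⟩; 0, 0, 1, 0;
        0, ⟨-q.imJ, -q.imK⟩, 0, ⟨q.re, q.imI⟩] := by
    rw [swap_mul_mul_swap, blockOne_two_eq]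
    ext i j
    fin_cases i <;> fin_cases j <;> rfl
  rw [h1, h2, hermitianInvolution_mul_mul]
  ext i j
  rw [Matrix.smul_apply, mul_apply, mul_apply, Fin.sum_univ_four, Fin.sum_univ_four, mul_apply,
    mul_apply, mul_apply, mul_apply, Fin.sum_univ_four, Fin.sum_univ_four, Fin.sum_univ_four,
    Fin.sum_univ_four]
  fin_cases i <;> fin_cases j <;> simp [leftMulMatrix, Complex.ext_iff] <;>
    constructor <;> ring

end ComplexRotation

section InducedMap

variable {ι : Type*}

theorem GenLoop.map_pointwiseMul {G H : Type*} [Monoid G] [TopologicalSpace G] [ContinuousMul G]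
    [Monoid H] [TopologicalSpace H] [ContinuousMul H] {φ : C(G, H)} (h1 : φ 1 = 1)
    (hφ : ∀ a b, φ (a * b) = φ a * φ b) (f g : Ω^ ι G 1) :
    map φ h1 (pointwiseMul f g) = pointwiseMul (map φ h1 f) (map φ h1 g) := by
  ext1 s
  exact hφ _ _

/-- The inclusion of special orthogonal groups into special unitary groups. -/
noncomputable def complexification (k : ℕ) : C(specialUnitary ℝ k, specialUnitary ℂ k) :=
  soEmbedding k

theorem complexification_one (k : ℕ) : complexification k 1 = 1 :=
  soEmbedding_one k

theorem complexification_mul (k : ℕ) (A B : specialUnitary ℝ k) :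
    complexification k (A * B) = complexification k A * complexification k B :=
  ext_matrix (map_mul Complex.ofRealHom.mapMatrix A.1.1 B.1.1)

/-- The loop in `SO(4)` of left multiplications by a loop of unit quaternions. -/
noncomputable def leftLoop (q : Ω^ ι (unitary ℍ[ℝ]) 1) : Ω^ ι (specialUnitary ℝ 4) 1 :=
  GenLoop.map ⟨leftRotation, continuous_leftRotation⟩ (map_one leftRotation) q

/-- The loop in `SO(4)` of right multiplications by a loop of unit quaternions. -/
noncomputable def rightLoop (q : Ω^ ι (unitary ℍ[ℝ]) 1) : Ω^ ι (specialUnitary ℝ 4) 1 :=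
  GenLoop.map ⟨rightRotation, continuous_rightRotation⟩ (map_one rightRotation) q

/-- The loop in `SU(4)` obtained from a loop in `SU(2)`, given by unit quaternions. -/
noncomputable def complexLoop (q : Ω^ ι (unitary ℍ[ℝ]) 1) : Ω^ ι (specialUnitary ℂ 4) 1 :=
  GenLoop.map (blockEmbedding ℂ 2 2) (blockEmbedding_one 2 2)
    (GenLoop.map unitaryQuaternionToSU unitaryQuaternionToSU_one q)

theorem homotopic_map_complexification_leftLoop (q : Ω^ ι (unitary ℍ[ℝ]) 1) :
    GenLoop.Homotopic (GenLoop.map (complexification 4) (complexification_one 4) (leftLoop q))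
      (GenLoop.pointwiseMul (complexLoop q) (complexLoop q)) := by
  obtain ⟨g, hg, hgs⟩ := exists_homotopic_conj star_hermitianInvolution hermitianInvolution_mul_self
    (GenLoop.map (complexification 4) (complexification_one 4) (leftLoop q))
  obtain ⟨a, ha, has⟩ := exists_homotopic_conj (star_swap_eq 1 2) (swap_mul_self 1 2)
    (complexLoop q)
  obtain ⟨b, hb, hbs⟩ := exists_homotopic_conj (star_swap_eq 0 3) (swap_mul_self 0 3)
    (complexLoop q)
  have h : g = GenLoop.pointwiseMul a b := by
    ext1 s
    apply ext_matrix
    change _ = (a s).1.1 * (b s).1.1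
    rw [hgs, has, hbs]
    exact hermitianInvolution_mul_leftMulMatrix_mul (q s)
  exact hg.trans (h ▸ (ha.pointwiseMul hb).symm)

theorem homotopic_map_complexification_rightLoop (q : Ω^ ι (unitary ℍ[ℝ]) 1) :
    GenLoop.Homotopic (GenLoop.map (complexification 4) (complexification_one 4) (rightLoop q))
      (GenLoop.map (complexification 4) (complexification_one 4) (leftLoop q)) := by
  have hK : star (Complex.ofRealHom.mapMatrix conjugationMatrix) =
      Complex.ofRealHom.mapMatrix conjugationMatrix := by
    ext i j
    fin_cases i <;> fin_cases j <;> simp [star_apply, conjugationMatrix]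
  obtain ⟨g, hg, hgs⟩ := exists_homotopic_conj hK
    (by rw [← map_mul, conjugationMatrix_mul_self, map_one])
    (GenLoop.map (complexification 4) (complexification_one 4) (leftLoop q))
  have h : g = GenLoop.map (complexification 4) (complexification_one 4) (rightLoop q) := by
    ext1 s
    apply ext_matrix
    rw [hgs]
    change _ = Complex.ofRealHom.mapMatrix (conjugationMatrix * leftMulMatrix (q s) *
      conjugationMatrix)
    rw [map_mul, map_mul]
    rfl
  exact h ▸ hg.symm

theorem complexification_blockEmbedding (k m : ℕ) (M : specialUnitary ℝ k) :
    complexification (k + m) (blockEmbedding ℝ k m M) =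
      blockEmbedding ℂ k m (complexification k M) := by
  apply ext_matrix
  change (blockOne m M.1.1).map Complex.ofReal = blockOne m (M.1.1.map Complex.ofReal)
  rw [blockOne, ← submatrix_map, fromBlocks_map]
  simp [blockOne, Matrix.map_one]

/-- The class in `SU(4 + m)` of a loop of unit quaternions, viewed as a loop in `SU(2)`. -/
noncomputable def complexClass (m : ℕ) (q : Ω^ ι (unitary ℍ[ℝ]) 1) :
    HomotopyGroup ι (specialUnitary ℂ (4 + m)) 1 :=
  GenLoop.homotopyClass
    (GenLoop.map (blockEmbedding ℂ 4 m) (blockEmbedding_one 4 m) (complexLoop q))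

/-- The class in `SO(4 + m)` of a loop in `SO(4)`. -/
noncomputable def realClass (m : ℕ) (f : Ω^ ι (specialUnitary ℝ 4) 1) :
    HomotopyGroup ι (specialUnitary ℝ (4 + m)) 1 :=
  GenLoop.homotopyClass (GenLoop.map (blockEmbedding ℝ 4 m) (blockEmbedding_one 4 m) f)

theorem induced_realClass (m : ℕ) (f : Ω^ ι (specialUnitary ℝ 4) 1) :
    HomotopyGroup.induced ι (complexification (4 + m)) (complexification_one (4 + m))
      (realClass m f) =
      GenLoop.homotopyClass (GenLoop.map (blockEmbedding ℂ 4 m) (blockEmbedding_one 4 m)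
        (GenLoop.map (complexification 4) (complexification_one 4) f)) := by
  change GenLoop.homotopyClass
    (GenLoop.map (complexification (4 + m)) (complexification_one (4 + m))
      (GenLoop.map (blockEmbedding ℝ 4 m) (blockEmbedding_one 4 m) f)) = _
  congr 1
  ext1 s
  exact complexification_blockEmbedding 4 m (f s)

variable [DecidableEq ι] [Nonempty ι]

theorem induced_realClass_leftLoop (m : ℕ) (q : Ω^ ι (unitary ℍ[ℝ]) 1) :
    HomotopyGroup.induced ι (complexification (4 + m)) (complexification_one (4 + m))
      (realClass m (leftLoop q)) = (complexClass m q * complexClass m q :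
        HomotopyGroup ι (specialUnitary ℂ (4 + m)) 1) := by
  rw [induced_realClass, ((homotopic_map_complexification_leftLoop q).map _ _).homotopyClass_eq,
    GenLoop.map_pointwiseMul (blockEmbedding_one 4 m) (blockEmbedding_mul m),
    GenLoop.homotopyClass_pointwiseMul]
  rfl

theorem induced_realClass_rightLoop (m : ℕ) (q : Ω^ ι (unitary ℍ[ℝ]) 1) :
    HomotopyGroup.induced ι (complexification (4 + m)) (complexification_one (4 + m))
      (realClass m (rightLoop q)) = (complexClass m q * complexClass m q :
        HomotopyGroup ι (specialUnitary ℂ (4 + m)) 1) := by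
  rw [← induced_realClass_leftLoop, induced_realClass, induced_realClass]
  exact ((homotopic_map_complexification_rightLoop q).map _ _).homotopyClass_eq

theorem induced_realClass_pointwiseMul (m : ℕ) (f g : Ω^ ι (specialUnitary ℝ 4) 1) :
    HomotopyGroup.induced ι (complexification (4 + m)) (complexification_one (4 + m))
      (realClass m (GenLoop.pointwiseMul f g)) =
    (HomotopyGroup.induced ι (complexification (4 + m)) (complexification_one (4 + m))
        (realClass m f) *
      HomotopyGroup.induced ι (complexification (4 + m)) (complexification_one (4 + m))
        (realClass m g) :
        HomotopyGroup ι (specialUnitary ℂ (4 + m)) 1) := by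
  rw [induced_realClass, induced_realClass, induced_realClass,
    GenLoop.map_pointwiseMul (complexification_one 4) (complexification_mul 4),
    GenLoop.map_pointwiseMul (blockEmbedding_one 4 m) (blockEmbedding_mul m)]
  exact GenLoop.homotopyClass_pointwiseMul _ _

end InducedMap

section ThirdHomotopyGroup

variable (m : ℕ)

theorem exists_realClass_eq (x : HomotopyGroup (Fin 3) (specialUnitary ℝ (4 + m)) 1) :
    ∃ p q : Ω^ (Fin 3) (unitary ℍ[ℝ]) 1,
      x = realClass m (GenLoop.pointwiseMul (leftLoop p) (rightLoop q)) := by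
  induction x using Quotient.inductionOn with
  | h f =>
    obtain ⟨f', hf, hfix⟩ := exists_homotopic_fixes (k := 4) (by norm_num) (by simp) f
    obtain ⟨g, hg⟩ := exists_map_blockEmbedding_eq f' hfix
    obtain ⟨p, q, rfl⟩ := exists_eq_pointwiseMul_map_rotation g
    refine ⟨p, q, hf.homotopyClass_eq.trans ?_⟩
    rw [← hg]
    rfl

theorem exists_complexClass_eq (x : HomotopyGroup (Fin 3) (specialUnitary ℂ (4 + m)) 1) :
    ∃ q : Ω^ (Fin 3) (unitary ℍ[ℝ]) 1, x = complexClass m q := by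
  induction x using Quotient.inductionOn with
  | h f =>
    obtain ⟨f', hf, hfix⟩ := exists_homotopic_fixes (k := 2) (by norm_num) (by simp) f
    obtain ⟨g, hg⟩ := exists_map_blockEmbedding_eq f' fun s i hi => hfix s i (by omega)
    have hgfix : ∀ s (i : Fin (2 + 2)), 2 ≤ (i : ℕ) → Fixes (g s) i := fun s i hi j => by
      have h := hfix s (Fin.castAdd m i) hi (Fin.castAdd m j)
      have hgs : f' s = blockEmbedding ℂ 4 m (g s) := by rw [← hg]; rfl
      rw [hgs, blockEmbedding_apply] at h
      simpa [blockOne, one_apply] using h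
    obtain ⟨h, hh⟩ := exists_map_blockEmbedding_eq (k := 2) (m := 2) g hgfix
    obtain ⟨q, rfl⟩ := exists_map_unitaryQuaternionToSU_eq h
    refine ⟨q, hf.homotopyClass_eq.trans ?_⟩
    rw [← hg, ← hh]
    rfl

end ThirdHomotopyGroup

/-- **Instantons in Partially Broken Gauge Groups**: for `N ≥ 5`, the image of the map
`π₃(SO(N), 1) → π₃(SU(N), 1)` induced by the inclusion `SO(N) ↪ SU(N)` is the subgroup of
squares of `π₃(SU(N), 1)` (the index of embedding is two). -/
theorem range_induced_pi3_SO_to_SU (N : ℕ) (hN : 5 ≤ N) :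
    Set.range (HomotopyGroup.induced (Fin 3) (soEmbedding N) (soEmbedding_one N)) =
      Set.range fun x : π_ 3 (↥(SU N)) 1 => x ^ 2 := by
  obtain ⟨m, rfl⟩ := Nat.exists_eq_add_of_le (show 4 ≤ N by omega)
  apply Set.Subset.antisymm
  · rintro _ ⟨x, rfl⟩
    obtain ⟨p, q, rfl⟩ := exists_realClass_eq m x
    refine ⟨(complexClass m p * complexClass m q : π_ 3 (specialUnitary ℂ (4 + m)) 1), ?_⟩
    have h := induced_realClass_pointwiseMul m (leftLoop p) (rightLoop q)
    rw [induced_realClass_leftLoop, induced_realClass_rightLoop] at h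
    refine (sq _).trans (Eq.trans ?_ h.symm)
    exact mul_mul_mul_comm _ _ _ _
  · rintro _ ⟨x, rfl⟩
    obtain ⟨q, rfl⟩ := exists_complexClass_eq m x
    exact ⟨realClass m (leftLoop q), (induced_realClass_leftLoop m q).trans (sq _).symm⟩

end
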